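/- Let $(M,g)$ be a Riemannian manifold of dimension $n\ge 3$ with Levi-Civita connection $\nabla$ and curvature tensor $R(X,Y)Z=\nabla_X\nabla_YZ-\nabla_Y\nabla_XZ-\nabla_{[X,Y]}Z$. For $x\in M$, $y\in T_xM$ and $u\in T_xM$, denote by $u^v\in T_{(x,y)}TM$ the vertical lift of $u$, that is, the velocity at $t=0$ of the curve $t\mapsto (x,y+tu)$, and by $u^h\in T_{(x,y)}TM$ the horizontal lift of $u$ with respect to $\nabla$, that is, $u^h=dY_x(u)-(\nabla_uY)^v$ for any vector field $Y$ near $x$ with $Y(x)=y$. Let $a,b,c$ be real constants with $a>0$ and $\alpha:=a(a+c)-b^2>0$, and let $G=a g^s+b g^h+c g^v$ be the $g$-natural Riemannian metric on the tangent bundle $TM$ given by $$G_{(x,y)}(u^h,w^h)=(a+c)\,g_x(u,w),\quad G_{(x,y)}(u^h,w^v)=G_{(x,y)}(u^v,w^h)=b\,g_x(u,w),\quad G_{(x,y)}(u^v,w^v)=a\,g_x(u,w)$$ for all $u,w\in T_xM$. If $(M,g)$ is flat, i.e. $R$ vanishes identically, then $(TM,G)$ is flat, i.e. the curvature tensor $\widetilde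 R$ of the Levi-Civita connection of $G$ vanishes identically. -/

import Mathlib

open Bundle VectorField
open scoped Manifold ContDiff

noncomputable section

set_option linter.unusedSectionVars false

namespace GNat

section LeviCivita

variable {E : Type*} [NormedAddCommGroup E] [NormedSpace ℝ E] [FiniteDimensional ℝ E]
  {H : Type*} [TopologicalSpace H] {I : ModelWithCorners ℝ E H}
  {M : Type*} [TopologicalSpace M] [ChartedSpace H M] [IsManifold I ∞ M]

/-- A smooth Riemannian metric on the manifold `M`. -/
abbrev RiemMetric {E : Type*} [NormedAddCommGroup E] [NormedSpace ℝ E]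
    {H : Type*} [TopologicalSpace H] (I : ModelWithCorners ℝ E H)
    (M : Type*) [TopologicalSpace M] [ChartedSpace H M] [IsManifold I ∞ M] :=
  ContMDiffRiemannianMetric I ∞ E (TangentSpace I : M → Type _)

/-- The right-hand side of the Koszul formula
`2 g(∇_X Y, Z) = X g(Y,Z) + Y g(X,Z) - Z g(X,Y) + g([X,Y],Z) - g([X,Z],Y) - g([Y,Z],X)`
at the point `x`. -/
def koszul (g : RiemMetric I M) (X Y Z : Π x : M, TangentSpace I x) (x : M) : ℝ :=
  d% (fun p ↦ g.inner p (Y p) (Z p)) x (X x)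
    + d% (fun p ↦ g.inner p (X p) (Z p)) x (Y x)
    - d% (fun p ↦ g.inner p (X p) (Y p)) x (Z x)
    + g.inner x (mlieBracket I X Y x) (Z x)
    - g.inner x (mlieBracket I X Z x) (Y x)
    - g.inner x (mlieBracket I Y Z x) (X x)

variable (g : RiemMetric I M) {X X' Y Y' Z Z' : Π x : M, TangentSpace I x} {x : M} {f : M → ℝ}

theorem mdiffAt_inner (hX : MDiffAt (T% X) x) (hY : MDiffAt (T% Y) x) :
    MDiffAt (fun p ↦ g.inner p (X p) (Y p)) x := by
  have : MDifferentiableAt I (I.prod 𝓘(ℝ))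
      (fun m ↦ TotalSpace.mk' ℝ (E := Bundle.Trivial M ℝ) m (g.inner m (X m) (Y m))) x := by
    apply MDifferentiableAt.clm_bundle_apply₂ (F₁ := E) (F₂ := E)
    · exact g.contMDiff.mdifferentiableAt (by simp)
    · exact hX
    · exact hY
  simp only [mdifferentiableAt_totalSpace] at this
  exact this.2

theorem d_inner_add_left (hX : MDiffAt (T% X) x) (hX' : MDiffAt (T% X') x)
    (hY : MDiffAt (T% Y) x) :
    d% (fun p ↦ g.inner p ((X + X') p) (Y p)) x
      = d% (fun p ↦ g.inner p (X p) (Y p)) x + d% (fun p ↦ g.inner p (X' p) (Y p)) x := by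
  rw [← mvfderiv_add (mdiffAt_inner g hX hY) (mdiffAt_inner g hX' hY)]
  congr 1
  ext p
  simp

theorem d_inner_smul_left (hf : MDiffAt f x) (hX : MDiffAt (T% X) x)
    (hY : MDiffAt (T% Y) x) :
    d% (fun p ↦ g.inner p ((f • X) p) (Y p)) x
      = f x • d% (fun p ↦ g.inner p (X p) (Y p)) x + g.inner x (X x) (Y x) • d% f x := by
  rw [← mvfderiv_mul hf (mdiffAt_inner g hX hY)]
  congr 1
  ext p
  simp

theorem inner_swap (X Y : Π x : M, TangentSpace I x) :
    (fun p ↦ g.inner p (X p) (Y p)) = fun p ↦ g.inner p (Y p) (X p) :=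
  funext fun p ↦ g.symm p _ _

theorem koszul_add₁ (hX : MDiffAt (T% X) x) (hX' : MDiffAt (T% X') x)
    (hY : MDiffAt (T% Y) x) (hZ : MDiffAt (T% Z) x) :
    koszul g (X + X') Y Z x = koszul g X Y Z x + koszul g X' Y Z x := by
  unfold koszul
  rw [d_inner_add_left g hX hX' hY, d_inner_add_left g hX hX' hZ,
    mlieBracket_add_left hX hX', mlieBracket_add_left hX hX']
  simp only [Pi.add_apply, map_add, add_apply]
  ring

theorem koszul_smul₁ (hf : MDiffAt f x) (hX : MDiffAt (T% X) x)
    (hY : MDiffAt (T% Y) x) (hZ : MDiffAt (T% Z) x) :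
    koszul g (f • X) Y Z x = f x * koszul g X Y Z x := by
  unfold koszul
  rw [d_inner_smul_left g hf hX hY, d_inner_smul_left g hf hX hZ,
    mlieBracket_smul_left hf hX, mlieBracket_smul_left hf hX]
  simp only [Pi.smul_apply', map_add, add_apply, map_smul, smul_apply, neg_smul, neg_apply,
    map_neg, smul_eq_mul]
  ring

theorem koszul_swap₁₂ (X Y Z : Π x : M, TangentSpace I x) (x : M) :
    koszul g X Y Z x = koszul g Y X Z x + 2 * g.inner x (mlieBracket I X Y x) (Z x) := by
  unfold koszul
  rw [inner_swap g Y X, mlieBracket_swap_apply (V := Y) (W := X)]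
  simp only [map_neg, neg_apply]
  ring

theorem koszul_swap₂₃ (X Y Z : Π x : M, TangentSpace I x) (x : M) :
    koszul g X Y Z x
      = 2 * d% (fun p ↦ g.inner p (Y p) (Z p)) x (X x) - koszul g X Z Y x := by
  unfold koszul
  rw [inner_swap g Z Y, mlieBracket_swap_apply (V := Z) (W := Y)]
  simp only [map_neg, neg_apply]
  ring

theorem koszul_add₂ (hX : MDiffAt (T% X) x) (hY : MDiffAt (T% Y) x)
    (hY' : MDiffAt (T% Y') x) (hZ : MDiffAt (T% Z) x) :
    koszul g X (Y + Y') Z x = koszul g X Y Z x + koszul g X Y' Z x := by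
  rw [koszul_swap₁₂ g X (Y + Y'), koszul_swap₁₂ g X Y, koszul_swap₁₂ g X Y',
    koszul_add₁ g hY hY' hX hZ, mlieBracket_add_right hY hY']
  simp only [map_add, add_apply]
  ring

theorem koszul_smul₂ (hf : MDiffAt f x) (hX : MDiffAt (T% X) x)
    (hY : MDiffAt (T% Y) x) (hZ : MDiffAt (T% Z) x) :
    koszul g X (f • Y) Z x
      = f x * koszul g X Y Z x + 2 * (d% f x (X x) * g.inner x (Y x) (Z x)) := by
  rw [koszul_swap₁₂ g X (f • Y), koszul_swap₁₂ g X Y, koszul_smul₁ g hf hY hX hZ,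
    mlieBracket_smul_right hf hY]
  simp only [map_add, add_apply, map_smul, smul_apply, smul_eq_mul]
  ring

theorem koszul_add₃ (hX : MDiffAt (T% X) x) (hY : MDiffAt (T% Y) x)
    (hZ : MDiffAt (T% Z) x) (hZ' : MDiffAt (T% Z') x) :
    koszul g X Y (Z + Z') x = koszul g X Y Z x + koszul g X Y Z' x := by
  rw [koszul_swap₂₃ g X Y (Z + Z'), koszul_swap₂₃ g X Y Z, koszul_swap₂₃ g X Y Z',
    koszul_add₂ g hX hZ hZ' hY, inner_swap g Y (Z + Z'), d_inner_add_left g hZ hZ' hY,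
    inner_swap g Y Z, inner_swap g Y Z']
  simp only [add_apply]
  ring

theorem koszul_smul₃ (hf : MDiffAt f x) (hX : MDiffAt (T% X) x)
    (hY : MDiffAt (T% Y) x) (hZ : MDiffAt (T% Z) x) :
    koszul g X Y (f • Z) x = f x * koszul g X Y Z x := by
  rw [koszul_swap₂₃ g X Y (f • Z), koszul_swap₂₃ g X Y Z, koszul_smul₂ g hf hX hZ hY,
    inner_swap g Y (f • Z), d_inner_smul_left g hf hZ hY, inner_swap g Y Z]
  simp only [add_apply, smul_apply, smul_eq_mul]
  ring

theorem tensorial_koszul₁ (hY : MDiffAt (T% Y) x) (hZ : MDiffAt (T% Z) x) :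
    TensorialAt I E (koszul g · Y Z x) x where
  smul hf hX := by simpa using koszul_smul₁ g hf hX hY hZ
  add hX hX' := koszul_add₁ g hX hX' hY hZ

theorem tensorial_koszul₃ (hX : MDiffAt (T% X) x) (hY : MDiffAt (T% Y) x) :
    TensorialAt I E (koszul g X Y · x) x where
  smul hf hZ := by simpa using koszul_smul₃ g hf hX hY hZ
  add hZ hZ' := koszul_add₃ g hX hY hZ hZ'

/-- The bilinear form `(u, w) ↦ 2 g(∇_u Y, w)` on the tangent space at `x`, for a vector field `Y`
differentiable at `x`. -/
def koszulForm (hY : MDiffAt (T% Y) x) :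
    TangentSpace I x →L[ℝ] TangentSpace I x →L[ℝ] ℝ :=
  TensorialAt.mkHom₂ (fun X Z ↦ koszul g X Y Z x) x
    (fun _ hZ ↦ tensorial_koszul₁ g hY hZ) (fun _ hX ↦ tensorial_koszul₃ g hX hY)

theorem koszulForm_apply (hX : MDiffAt (T% X) x) (hY : MDiffAt (T% Y) x)
    (hZ : MDiffAt (T% Z) x) : koszulForm g hY (X x) (Z x) = koszul g X Y Z x :=
  TensorialAt.mkHom₂_apply (Φ := fun X Z ↦ koszul g X Y Z x)
    (fun _ hZ ↦ tensorial_koszul₁ g hY hZ) (fun _ hX ↦ tensorial_koszul₃ g hX hY) hX hZ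

theorem eq_of_inner_eq {u v : TangentSpace I x} (h : ∀ w, g.inner x u w = g.inner x v w) :
    u = v := by
  by_contra hne
  have h1 := g.pos x (u - v) (sub_ne_zero.2 hne)
  have h2 := h (u - v)
  simp only [map_sub, sub_apply] at h1 h2
  linarith

theorem exists_sharp (B : TangentSpace I x →L[ℝ] TangentSpace I x →L[ℝ] ℝ) :
    ∃ A : TangentSpace I x →L[ℝ] TangentSpace I x, ∀ u w, 2 * g.inner x (A u) w = B u w := by
  have : FiniteDimensional ℝ (TangentSpace I x) := inferInstanceAs (FiniteDimensional ℝ E)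
  have : T2Space (TangentSpace I x) := inferInstanceAs (T2Space E)
  let L : TangentSpace I x →ₗ[ℝ] Module.Dual ℝ (TangentSpace I x) :=
    { toFun := fun u ↦ (g.inner x u : TangentSpace I x →ₗ[ℝ] ℝ)
      map_add' := fun u v ↦ by ext; simp
      map_smul' := fun r u ↦ by ext; simp }
  have hL : Function.Injective L := fun u v huv ↦
    eq_of_inner_eq g fun w ↦ by simpa [L] using LinearMap.congr_fun huv w
  let e := LinearEquiv.ofInjectiveOfFinrankEq L hL (Subspace.dual_finrank_eq).symm
  let B' : TangentSpace I x →ₗ[ℝ] Module.Dual ℝ (TangentSpace I x) :=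
    { toFun := fun u ↦ (B u : TangentSpace I x →ₗ[ℝ] ℝ)
      map_add' := fun u v ↦ by ext; simp
      map_smul' := fun r u ↦ by ext; simp }
  refine ⟨LinearMap.toContinuousLinearMap ((2 : ℝ)⁻¹ • (e.symm.toLinearMap ∘ₗ B')), fun u w ↦ ?_⟩
  have h1 : L (e.symm (B' u)) = B' u := e.apply_symm_apply (B' u)
  have h2 : g.inner x (e.symm (B' u)) w = B u w := LinearMap.congr_fun h1 w
  simp [h2]

open Classical in
/-- The endomorphism `u ↦ (∇_u Y)(x)` of the tangent space at `x`, determined by the Koszul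
formula; it is set to zero if `Y` is not differentiable at `x`. -/
def nabla (Y : Π x : M, TangentSpace I x) (x : M) : TangentSpace I x →L[ℝ] TangentSpace I x :=
  if hY : MDiffAt (T% Y) x then (exists_sharp g (koszulForm g hY)).choose else 0

theorem inner_nabla (hX : MDiffAt (T% X) x) (hY : MDiffAt (T% Y) x) (hZ : MDiffAt (T% Z) x) :
    2 * g.inner x (nabla g Y x (X x)) (Z x) = koszul g X Y Z x := by
  rw [nabla, dif_pos hY, (exists_sharp g (koszulForm g hY)).choose_spec,
    koszulForm_apply g hX hY hZ]

theorem nabla_ext {A B : TangentSpace I x →L[ℝ] TangentSpace I x}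
    (h : ∀ X Z : Π x : M, TangentSpace I x, MDiffAt (T% X) x → MDiffAt (T% Z) x →
      g.inner x (A (X x)) (Z x) = g.inner x (B (X x)) (Z x)) : A = B := by
  ext1 u
  refine eq_of_inner_eq g fun w ↦ ?_
  simpa using h (FiberBundle.extend E u) (FiberBundle.extend E w)
    (FiberBundle.mdifferentiableAt_extend ..) (FiberBundle.mdifferentiableAt_extend ..)

/-- The Levi-Civita connection of the Riemannian metric `g`. As in Mathlib, `leviCivita g Y x (X x)`
is the value at `x` of `∇_X Y`. -/
def leviCivita : CovariantDerivative I E (TangentSpace I : M → Type _) where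
  toFun := nabla g
  isCovariantDerivativeOnUniv :=
    { add := fun {Y Y' x} hY hY' _ ↦ nabla_ext g fun X Z hX hZ ↦ by
        have h := koszul_add₂ g hX hY hY' hZ
        rw [← inner_nabla g hX (mdifferentiableAt_add_section hY hY') hZ, ← inner_nabla g hX hY hZ,
          ← inner_nabla g hX hY' hZ] at h
        simp only [add_apply, map_add]
        linarith
      leibniz := fun {Y f x} hY hf _ ↦ nabla_ext g fun X Z hX hZ ↦ by
        have h := koszul_smul₂ g hf hX hY hZ
        rw [← inner_nabla g hX (hf.smul_section hY) hZ, ← inner_nabla g hX hY hZ] at h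
        simp only [add_apply, map_add, smul_apply, map_smul, smul_eq_mul,
          ContinuousLinearMap.smulRight_apply]
        linarith }

/-- The Levi-Civita connection is torsion-free. -/
theorem leviCivita_torsion (hX : MDiffAt (T% X) x) (hY : MDiffAt (T% Y) x) :
    leviCivita g Y x (X x) - leviCivita g X x (Y x) = mlieBracket I X Y x := by
  refine eq_of_inner_eq g fun w ↦ ?_
  have hw := FiberBundle.mdifferentiableAt_extend (F := E) I w
  have h := koszul_swap₁₂ g X Y (FiberBundle.extend E w) x
  rw [← inner_nabla g hX hY hw, ← inner_nabla g hY hX hw] at h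
  simp only [FiberBundle.extend_apply_self] at h
  change g.inner x (nabla g Y x (X x) - nabla g X x (Y x)) w = _
  simp only [map_sub, sub_apply]
  linarith

/-- The Levi-Civita connection is compatible with the metric. -/
theorem leviCivita_metric (hX : MDiffAt (T% X) x) (hY : MDiffAt (T% Y) x)
    (hZ : MDiffAt (T% Z) x) :
    d% (fun p ↦ g.inner p (Y p) (Z p)) x (X x)
      = g.inner x (leviCivita g Y x (X x)) (Z x) + g.inner x (Y x) (leviCivita g Z x (X x)) := by
  have h := koszul_swap₂₃ g X Y Z x
  rw [← inner_nabla g hX hY hZ, ← inner_nabla g hX hZ hY] at h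
  rw [g.symm x (Y x)]
  change _ = g.inner x (nabla g Y x (X x)) (Z x) + g.inner x (nabla g Z x (X x)) (Y x)
  linarith

/-- The curvature `R(X,Y)Z = ∇_X ∇_Y Z - ∇_Y ∇_X Z - ∇_[X,Y] Z` of the Levi-Civita connection of
`g`, at the point `x`. -/
def curvature (X Y Z : Π x : M, TangentSpace I x) (x : M) : TangentSpace I x :=
  leviCivita g (fun p ↦ leviCivita g Z p (Y p)) x (X x)
    - leviCivita g (fun p ↦ leviCivita g Z p (X p)) x (Y x)
    - leviCivita g Z x (mlieBracket I X Y x)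

/-- The metric `g` is flat: `R(X,Y)Z` vanishes at each point `x`, for all vector fields `X, Y, Z`
that are smooth around `x`. -/
def IsFlat : Prop :=
  ∀ (x : M) (X Y Z : Π x : M, TangentSpace I x),
    CMDiffAt ∞ (T% X) x → CMDiffAt ∞ (T% Y) x → CMDiffAt ∞ (T% Z) x → curvature g X Y Z x = 0

end LeviCivita

section Lifts

variable {E : Type*} [NormedAddCommGroup E] [NormedSpace ℝ E] [FiniteDimensional ℝ E]
  {H : Type*} [TopologicalSpace H] {I : ModelWithCorners ℝ E H}
  {M : Type*} [TopologicalSpace M] [ChartedSpace H M] [IsManifold I ∞ M]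

/-- The vertical lift of `v ∈ T_x M` to the point `ξ = (x, y)` of `TM`: the velocity at `t = 0` of
the curve `t ↦ (x, y + t v)` in the fibre. (The curve is at `(x, y + 0 v)`, which is `ξ`, at time
`0`; the type of `dγ` only records this.) -/
def vLift (ξ : TangentBundle I M) (v : TangentSpace I ξ.proj) : TangentSpace I.tangent ξ :=
  let dγ : ℝ →L[ℝ] TangentSpace I.tangent ξ :=
    mfderiv 𝓘(ℝ, ℝ) I.tangent
      (fun t : ℝ ↦ (⟨ξ.proj, ξ.2 + t • v⟩ : TangentBundle I M)) 0
  dγ 1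

variable (g : RiemMetric I M)

/-- The horizontal lift of `u ∈ T_x M` to the point `ξ = (x, y)` of `TM`, with respect to the
Levi-Civita connection `∇` of `g`: it is `dY_x(u) - (∇_u Y)ᵛ`, where `Y` is a vector field around
`x` with `Y x = y`. Here `Y` is the vector field whose components in the chart around `x` are
constant, so that this is `u - y^a Γ_{ai}^j u^i ∂/∂y^j` in the induced coordinates `(x, y)`. -/
def hLift (ξ : TangentBundle I M) (u : TangentSpace I ξ.proj) : TangentSpace I.tangent ξ :=
  let dY : TangentSpace I ξ.proj →L[ℝ] TangentSpace I.tangent ξ :=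
    mfderiv I I.tangent
      (fun p ↦ (⟨p, FiberBundle.extend E ξ.2 p⟩ : TangentBundle I M)) ξ.proj
  dY u - vLift ξ (leviCivita g (FiberBundle.extend E ξ.2) ξ.proj u)

/-- `G` is the `g`-natural metric `a gˢ + b gʰ + c gᵛ` on `TM`. -/
structure IsGNatural (a b c : ℝ) (G : RiemMetric I.tangent (TangentBundle I M)) : Prop where
  hh : ∀ (ξ : TangentBundle I M) (u v : TangentSpace I ξ.proj),
    G.inner ξ (hLift g ξ u) (hLift g ξ v) = (a + c) * g.inner ξ.proj u v
  hv : ∀ (ξ : TangentBundle I M) (u v : TangentSpace I ξ.proj),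
    G.inner ξ (hLift g ξ u) (vLift ξ v) = b * g.inner ξ.proj u v
  vh : ∀ (ξ : TangentBundle I M) (u v : TangentSpace I ξ.proj),
    G.inner ξ (vLift ξ u) (hLift g ξ v) = b * g.inner ξ.proj u v
  vv : ∀ (ξ : TangentBundle I M) (u v : TangentSpace I ξ.proj),
    G.inner ξ (vLift ξ u) (vLift ξ v) = a * g.inner ξ.proj u v

end Lifts

end GNat

end

noncomputable section

set_option linter.unusedSectionVars false

namespace GNat

section Calculus

open Set Filter
open scoped Topology

variable {E : Type*} [NormedAddCommGroup E] [NormedSpace ℝ E]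
  {H : Type*} [TopologicalSpace H] {I : ModelWithCorners ℝ E H}
  {M : Type*} [TopologicalSpace M] [ChartedSpace H M] [IsManifold I ∞ M]
  {E' : Type*} [NormedAddCommGroup E'] [NormedSpace ℝ E']
  {H' : Type*} [TopologicalSpace H'] {I' : ModelWithCorners ℝ E' H'}
  {N : Type*} [TopologicalSpace N] [ChartedSpace H' N]

theorem contMDiffAt_inner (g : RiemMetric I M) {b : N → M} {v w : ∀ p, TangentSpace I (b p)}
    {x : N} (hv : ContMDiffAt I' I.tangent ∞ (fun p ↦ (⟨b p, v p⟩ : TangentBundle I M)) x)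
    (hw : ContMDiffAt I' I.tangent ∞ (fun p ↦ (⟨b p, w p⟩ : TangentBundle I M)) x) :
    ContMDiffAt I' 𝓘(ℝ, ℝ) ∞ (fun p ↦ g.inner (b p) (v p) (w p)) x := by
  have hb : ContMDiffAt I' I ∞ b x := by
    simp only [contMDiffAt_totalSpace] at hv
    exact hv.1
  have : ContMDiffAt I' (I.prod 𝓘(ℝ)) ∞
      (fun m ↦ TotalSpace.mk' ℝ (E := Bundle.Trivial M ℝ) (b m) (g.inner (b m) (v m) (w m))) x := by
    apply ContMDiffAt.clm_bundle_apply₂ (F₁ := E) (F₂ := E)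
    · exact ContMDiffAt.comp x g.contMDiff.contMDiffAt hb
    · exact hv
    · exact hw
  simp only [contMDiffAt_totalSpace] at this
  exact this.2

variable [IsManifold I' ∞ N]

theorem contMDiffAt_mfderiv_apply {f : N → M} {W : Π p : N, TangentSpace I' p} {x : N}
    (hf : ContMDiffAt I' I ∞ f x) (hW : CMDiffAt ∞ (T% W) x) :
    ContMDiffAt I' I.tangent ∞
      (fun p ↦ (⟨f p, mfderiv I' I f p (W p)⟩ : TangentBundle I M)) x := by
  have h : ContMDiffAt I' 𝓘(ℝ, E' →L[ℝ] E) ∞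
    (inTangentCoordinates I' I id f (mfderiv I' I f) x) x := hf.mfderiv_const (by simp)
  exact ContMDiffAt.clm_apply_of_inCoordinates (b₁ := id) (b₂ := f) h hW hf

theorem contMDiffAt_mvfderiv_apply {f : N → ℝ} {W : Π p : N, TangentSpace I' p} {x : N}
    (hf : CMDiffAt ∞ f x) (hW : CMDiffAt ∞ (T% W) x) :
    CMDiffAt ∞ (fun p ↦ d% f p (W p)) x := by
  have h := contMDiffAt_mfderiv_apply hf hW
  simp only [contMDiffAt_totalSpace] at h
  refine h.2.congr_of_eventuallyEq (Eventually.of_forall fun p ↦ ?_)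
  simp
  rfl

theorem fderivWithin_comp_extChartAt_symm {x : M} {h : M → ℝ} {y : E}
    (hy : y ∈ (extChartAt I x).target) (hh : MDiffAt h ((extChartAt I x).symm y)) :
    fderivWithin ℝ (h ∘ (extChartAt I x).symm) (range I) y
      = (d% h ((extChartAt I x).symm y)).comp
        (mfderivWithin 𝓘(ℝ, E) I (extChartAt I x).symm (range I) y) := by
  rw [← mfderivWithin_eq_fderivWithin]
  exact mfderiv_comp_mfderivWithin y hh (mdifferentiableWithinAt_extChartAt_symm hy)
    (I.uniqueMDiffOn y (extChartAt_target_subset_range x hy))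

theorem fderivWithin_comp_extChartAt_symm_mpullbackWithin {x : M} {h : M → ℝ} {y : E}
    (hy : y ∈ (extChartAt I x).target) (hh : MDiffAt h ((extChartAt I x).symm y))
    (V : Π p : M, TangentSpace I p) :
    fderivWithin ℝ (h ∘ (extChartAt I x).symm) (range I) y
      (mpullbackWithin 𝓘(ℝ, E) I (extChartAt I x).symm V (range I) y)
      = d% h ((extChartAt I x).symm y) (V ((extChartAt I x).symm y)) := by
  rw [fderivWithin_comp_extChartAt_symm hy hh]
  have := (isInvertible_mfderivWithin_extChartAt_symm hy).self_apply_inverse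
    (V ((extChartAt I x).symm y))
  exact congrArg (d% h ((extChartAt I x).symm y)) this

variable [CompleteSpace E]

/-- The Lie bracket acts on functions as the commutator of the derivations. -/
theorem mvfderiv_mlieBracket {f : M → ℝ} {V W : Π p : M, TangentSpace I p} {x : M}
    (hf : CMDiffAt ∞ f x) (hV : CMDiffAt ∞ (T% V) x) (hW : CMDiffAt ∞ (T% W) x) :
    d% f x (mlieBracket I V W x)
      = d% (fun p ↦ d% f p (W p)) x (V x) - d% (fun p ↦ d% f p (V p)) x (W x) := by
  set y₀ := extChartAt I x x
  have hy₀t : y₀ ∈ (extChartAt I x).target := mem_extChartAt_target x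
  have hinv : (extChartAt I x).symm y₀ = x := extChartAt_to_inv x
  have hdf : ContDiffWithinAt ℝ ∞ (f ∘ (extChartAt I x).symm) (range I) y₀ := by
    exact (contMDiffAt_iff.1 hf).2
  have hV' := (hV.mdifferentiableAt (by simp)).mdifferentiableWithinAt (s := univ)
    |>.differentiableWithinAt_mpullbackWithin_vectorField
  have hW' := (hW.mdifferentiableAt (by simp)).mdifferentiableWithinAt (s := univ)
    |>.differentiableWithinAt_mpullbackWithin_vectorField
  rw [preimage_univ, univ_inter] at hV' hW'
  have key := fderivWithin_apply_lieBracket hdf (by simpa using ENat.LEInfty.out) I.uniqueDiffOn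
    (I.range_subset_closure_interior (mem_range_self _)) (mem_range_self _) hW' hV'
  have hnear : ∀ᶠ y in 𝓝[range I] y₀, y ∈ (extChartAt I x).target ∧
      MDiffAt f ((extChartAt I x).symm y) := by
    refine Eventually.and (extChartAt_target_mem_nhdsWithin x) ?_
    have h1 : ∀ᶠ p in 𝓝 x, MDiffAt f p :=
      ((contMDiffAt_iff_contMDiffAt_nhds (n := 1) (by simp)).1 (hf.of_le (by simp))).mono
        fun p hp ↦ hp.mdifferentiableAt (by simp)
    have h2 : Tendsto (extChartAt I x).symm (𝓝[range I] y₀) (𝓝 x) := by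
      have := (continuousAt_extChartAt_symm (I := I) x).tendsto
      rw [extChartAt_to_inv] at this
      exact this.mono_left nhdsWithin_le_nhds
    exact h2.eventually h1
  have side : ∀ V W : Π p : M, TangentSpace I p, CMDiffAt ∞ (T% W) x →
      fderivWithin ℝ (fun y ↦ fderivWithin ℝ (f ∘ (extChartAt I x).symm) (range I) y
        (mpullbackWithin 𝓘(ℝ, E) I (extChartAt I x).symm W (range I) y)) (range I) y₀
        (mpullbackWithin 𝓘(ℝ, E) I (extChartAt I x).symm V (range I) y₀)
      = d% (fun p ↦ d% f p (W p)) x (V x) := by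
    intro V W hW
    have h1 : (fun y ↦ fderivWithin ℝ (f ∘ (extChartAt I x).symm) (range I) y
        (mpullbackWithin 𝓘(ℝ, E) I (extChartAt I x).symm W (range I) y))
        =ᶠ[𝓝[range I] y₀] (fun p ↦ d% f p (W p)) ∘ (extChartAt I x).symm :=
      hnear.mono fun y hy ↦ fderivWithin_comp_extChartAt_symm_mpullbackWithin hy.1 hy.2 W
    have h2 := (contMDiffAt_mvfderiv_apply hf hW).mdifferentiableAt (by simp)
    rw [← hinv] at h2
    rw [h1.fderivWithin_eq_of_mem (mem_range_self _),
      fderivWithin_comp_extChartAt_symm_mpullbackWithin hy₀t h2, hinv]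
  rw [side V W hW, side W V hV] at key
  have hb : mlieBracket I V W x = lieBracketWithin ℝ
      (mpullbackWithin 𝓘(ℝ, E) I (extChartAt I x).symm V (range I))
      (mpullbackWithin 𝓘(ℝ, E) I (extChartAt I x).symm W (range I)) (range I) y₀ := by
    rw [← mlieBracketWithin_univ, mlieBracketWithin_apply, mfderiv_extChartAt_self,
      preimage_univ, univ_inter]
    exact DFunLike.congr_fun ContinuousLinearMap.inverse_id _
  rw [← key, hb]
  exact DFunLike.congr_fun (hf.mdifferentiableAt (by simp)).mvfderiv _

end Calculus

section Smoothness

open Set Filter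
open scoped Topology

variable {E : Type*} [NormedAddCommGroup E] [NormedSpace ℝ E] [FiniteDimensional ℝ E]
  {H : Type*} [TopologicalSpace H] {I : ModelWithCorners ℝ E H}
  {M : Type*} [TopologicalSpace M] [ChartedSpace H M] [IsManifold I ∞ M]
  (g : RiemMetric I M) {X Y Z W : Π x : M, TangentSpace I x} {x : M}

/-- A vector field is smooth at a point as soon as its inner products with all smooth vector fields
are. -/
theorem contMDiffAt_of_inner {V : Π x : M, TangentSpace I x}
    (h : ∀ W : Π x : M, TangentSpace I x, CMDiffAt ∞ (T% W) x →
      CMDiffAt ∞ (fun p ↦ g.inner p (V p) (W p)) x) : CMDiffAt ∞ (T% V) x := by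
  let e := trivializationAt E (TangentSpace I : M → Type _) x
  have hxe : x ∈ e.baseSet := FiberBundle.mem_baseSet_trivializationAt' x
  let b := Module.finBasis ℝ E
  let ι := Fin (Module.finrank ℝ E)
  let s : ι → Π p : M, TangentSpace I p := e.localFrame b
  have hs : ∀ i, CMDiffAt ∞ (T% (s i)) x := fun i ↦ contMDiffAt_localFrame_of_mem _ e b i hxe
  let c : M → ι → ℝ := fun p j ↦ e.localFrameCoeff I b j p (V p)
  let B : ι → ι → (ι → ℝ) →L[ℝ] (ι → ℝ) := fun i j ↦
    (ContinuousLinearMap.proj j : (ι → ℝ) →L[ℝ] ℝ).smulRight (Pi.single i (1 : ℝ))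
  let A : M → (ι → ℝ) →L[ℝ] (ι → ℝ) := fun p ↦ ∑ i, ∑ j, g.inner p (s j p) (s i p) • B i j
  have hAapply : ∀ p (v : ι → ℝ) i, A p v i = g.inner p (∑ j, v j • s j p) (s i p) := by
    intro p v i
    simp [A, B, Finset.sum_apply, Pi.single_apply, mul_comm]
  have hAsmooth : ContMDiffAt I 𝓘(ℝ, (ι → ℝ) →L[ℝ] (ι → ℝ)) ∞ A x := by
    refine contMDiffAt_finsetSum fun i _ ↦ contMDiffAt_finsetSum fun j _ ↦ ?_
    exact (contMDiffAt_inner g (hs j) (hs i)).smul contMDiffAt_const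
  have hAinv : ∀ p ∈ e.baseSet, (A p).IsInvertible := by
    intro p hp
    have hinj : Function.Injective (A p) := by
      refine (injective_iff_map_eq_zero _).2 fun v hv ↦ ?_
      have h0 : ∑ j, v j • s j p = 0 := by
        by_contra hne
        have h1 := g.pos p _ hne
        have h2 : g.inner p (∑ j, v j • s j p) (∑ i, v i • s i p) = 0 := by
          rw [map_sum]
          refine Finset.sum_eq_zero fun i _ ↦ ?_
          rw [map_smul, ← hAapply, hv]
          simp
        exact h1.ne' h2
      have hli := (e.isLocalFrameOn_localFrame_baseSet I 1 b).linearIndependent hp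
      exact funext (Fintype.linearIndependent_iff.1 hli v h0)
    exact ⟨(LinearEquiv.ofInjectiveEndo (A p : (ι → ℝ) →ₗ[ℝ] (ι → ℝ)) hinj).toContinuousLinearEquiv,
      by ext; rfl⟩
  have hc : ∀ᶠ p in 𝓝 x, c p = (A p).inverse (fun i ↦ g.inner p (V p) (s i p)) := by
    filter_upwards [e.open_baseSet.mem_nhds hxe] with p hp
    have h1 : A p (c p) = fun i ↦ g.inner p (V p) (s i p) := by
      funext i
      rw [hAapply]
      congr 2
      exact (e.eq_sum_localFrameCoeff_smul (I := I) (b := b) (s := V) hp).symm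
    rw [← h1, (hAinv p hp).inverse_apply_self]
  have hcs : ContMDiffAt I 𝓘(ℝ, ι → ℝ) ∞ c x := by
    refine ContMDiffAt.congr_of_eventuallyEq ?_ hc
    refine ContMDiffAt.clm_apply ?_ (contMDiffAt_pi_space.2 fun i ↦ h _ (hs i))
    exact ((hAinv x hxe).contDiffAt_map_inverse.contMDiffAt).comp x hAsmooth
  rw [contMDiffAt_iff_localFrameCoeff b hxe]
  exact fun i ↦ contMDiffAt_pi_space.1 hcs i

theorem eventually_mdiffAt (hX : CMDiffAt ∞ (T% X) x) : ∀ᶠ p in 𝓝 x, MDiffAt (T% X) p :=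
  ((contMDiffAt_iff_contMDiffAt_nhds (n := 1) (by simp)).1 (hX.of_le (by simp))).mono
    fun p hp ↦ hp.mdifferentiableAt (by simp)

theorem contMDiffAt_mlieBracket (hX : CMDiffAt ∞ (T% X) x) (hY : CMDiffAt ∞ (T% Y) x) :
    CMDiffAt ∞ (T% (mlieBracket I X Y)) x := by
  have : IsManifold I (minSmoothness ℝ 2) M := by
    rw [minSmoothness_of_isRCLikeNormedField]
    infer_instance
  have : IsManifold I (((⊤ : ℕ∞) : ℕ∞ω) + 1) M := inferInstanceAs (IsManifold I ∞ M)
  exact ContMDiffAt.mlieBracket_vectorField (m := ⊤) (n := ⊤) hX hY (by simp)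

theorem contMDiffAt_koszul (hX : CMDiffAt ∞ (T% X) x) (hY : CMDiffAt ∞ (T% Y) x)
    (hZ : CMDiffAt ∞ (T% Z) x) : CMDiffAt ∞ (koszul g X Y Z) x := by
  unfold koszul
  have h1 := contMDiffAt_mvfderiv_apply (contMDiffAt_inner g hY hZ) hX
  have h2 := contMDiffAt_mvfderiv_apply (contMDiffAt_inner g hX hZ) hY
  have h3 := contMDiffAt_mvfderiv_apply (contMDiffAt_inner g hX hY) hZ
  have h4 := contMDiffAt_inner g (contMDiffAt_mlieBracket hX hY) hZ
  have h5 := contMDiffAt_inner g (contMDiffAt_mlieBracket hX hZ) hY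
  have h6 := contMDiffAt_inner g (contMDiffAt_mlieBracket hY hZ) hX
  exact ((((h1.add h2).sub h3).add h4).sub h5).sub h6

theorem contMDiffAt_leviCivita (hX : CMDiffAt ∞ (T% X) x) (hY : CMDiffAt ∞ (T% Y) x) :
    CMDiffAt ∞ (T% (fun p ↦ leviCivita g Y p (X p))) x := by
  refine contMDiffAt_of_inner g fun W hW ↦ ?_
  refine ContMDiffAt.congr_of_eventuallyEq
    (contMDiffAt_const (I' := 𝓘(ℝ)) (c := (2⁻¹ : ℝ)) |>.smul (contMDiffAt_koszul g hX hY hW)) ?_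
  filter_upwards [eventually_mdiffAt hX, eventually_mdiffAt hY, eventually_mdiffAt hW]
    with p h1 h2 h3
  have := inner_nabla g h1 h2 h3
  change g.inner p (nabla g Y p (X p)) (W p) = 2⁻¹ * koszul g X Y W p
  linarith

theorem mvfderiv_congr {f f' : M → ℝ} (h : f =ᶠ[𝓝 x] f') : d% f x = d% f' x := by
  unfold mvfderiv
  rw [h.mfderiv_eq, h.eq_of_nhds]

theorem koszul_congr {Y' : Π x : M, TangentSpace I x} (h : ∀ᶠ p in 𝓝 x, Y p = Y' p) :
    koszul g X Y Z x = koszul g X Y' Z x := by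
  unfold koszul
  rw [mvfderiv_congr (h.mono fun p hp ↦ by simp only [hp] :
      (fun p ↦ g.inner p (Y p) (Z p)) =ᶠ[𝓝 x] fun p ↦ g.inner p (Y' p) (Z p)),
    mvfderiv_congr (h.mono fun p hp ↦ by simp only [hp] :
      (fun p ↦ g.inner p (X p) (Y p)) =ᶠ[𝓝 x] fun p ↦ g.inner p (X p) (Y' p)),
    h.self_of_nhds, EventuallyEq.mlieBracket_vectorField_eq (V₁ := X) (V := X) (.refl _ _) h,
    EventuallyEq.mlieBracket_vectorField_eq (W₁ := Z) (W := Z) h (.refl _ _)]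

theorem leviCivita_congr {Y' : Π x : M, TangentSpace I x} (hY : MDiffAt (T% Y) x)
    (h : ∀ᶠ p in 𝓝 x, Y p = Y' p) : leviCivita g Y x = leviCivita g Y' x := by
  have hY' : MDiffAt (T% Y') x := hY.congr_of_eventuallyEq (h.mono fun p hp ↦ by simp [hp])
  refine nabla_ext g fun X Z hX hZ ↦ ?_
  have h1 := inner_nabla g hX hY hZ
  have h2 := inner_nabla g hX hY' hZ
  have h3 := koszul_congr g (X := X) (Z := Z) h
  change g.inner x (nabla g Y x (X x)) (Z x) = g.inner x (nabla g Y' x (X x)) (Z x)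
  linarith

end Smoothness

section Curvature

open Set Filter
open scoped Topology

variable {E : Type*} [NormedAddCommGroup E] [NormedSpace ℝ E] [FiniteDimensional ℝ E]
  {H : Type*} [TopologicalSpace H] {I : ModelWithCorners ℝ E H}
  {M : Type*} [TopologicalSpace M] [ChartedSpace H M] [IsManifold I ∞ M]
  (g : RiemMetric I M) {X Y Z W : Π x : M, TangentSpace I x} {x : M}

theorem leviCivita_add (hY : MDiffAt (T% Y) x) (hZ : MDiffAt (T% Z) x) :
    leviCivita g (Y + Z) x = leviCivita g Y x + leviCivita g Z x :=
  (leviCivita g).isCovariantDerivativeOnUniv.add hY hZ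

theorem mvfderiv_mvfderiv_inner (hX : CMDiffAt ∞ (T% X) x) (hY : CMDiffAt ∞ (T% Y) x)
    (hZ : CMDiffAt ∞ (T% Z) x) (hW : CMDiffAt ∞ (T% W) x) :
    d% (fun p ↦ d% (fun q ↦ g.inner q (Z q) (W q)) p (Y p)) x (X x)
      = g.inner x (leviCivita g (fun p ↦ leviCivita g Z p (Y p)) x (X x)) (W x)
        + g.inner x (leviCivita g Z x (Y x)) (leviCivita g W x (X x))
        + (g.inner x (leviCivita g Z x (X x)) (leviCivita g W x (Y x))
        + g.inner x (Z x) (leviCivita g (fun p ↦ leviCivita g W p (Y p)) x (X x))) := by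
  have hZY := (contMDiffAt_leviCivita g hY hZ).mdifferentiableAt (by simp)
  have hWY := (contMDiffAt_leviCivita g hY hW).mdifferentiableAt (by simp)
  have hX1 := hX.mdifferentiableAt (by simp)
  have hZ1 := hZ.mdifferentiableAt (by simp)
  have hW1 := hW.mdifferentiableAt (by simp)
  have h : (fun p ↦ d% (fun q ↦ g.inner q (Z q) (W q)) p (Y p)) =ᶠ[𝓝 x]
      (fun p ↦ g.inner p (leviCivita g Z p (Y p)) (W p))
        + fun p ↦ g.inner p (Z p) (leviCivita g W p (Y p)) := by
    filter_upwards [eventually_mdiffAt hY, eventually_mdiffAt hZ, eventually_mdiffAt hW]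
      with p h1 h2 h3
    exact leviCivita_metric g h1 h2 h3
  rw [mvfderiv_congr h, mvfderiv_add (mdiffAt_inner g hZY hW1) (mdiffAt_inner g hZ1 hWY),
    add_apply, leviCivita_metric g hX1 hZY hW1, leviCivita_metric g hX1 hZ1 hWY]

theorem inner_curvature_skew (hX : CMDiffAt ∞ (T% X) x) (hY : CMDiffAt ∞ (T% Y) x)
    (hZ : CMDiffAt ∞ (T% Z) x) (hW : CMDiffAt ∞ (T% W) x) :
    g.inner x (curvature g X Y Z x) (W x) = - g.inner x (Z x) (curvature g X Y W x) := by
  have h := mvfderiv_mlieBracket (contMDiffAt_inner g hZ hW) hX hY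
  rw [mvfderiv_mvfderiv_inner g hX hY hZ hW, mvfderiv_mvfderiv_inner g hY hX hZ hW,
    leviCivita_metric g ((contMDiffAt_mlieBracket hX hY).mdifferentiableAt (by simp))
      (hZ.mdifferentiableAt (by simp)) (hW.mdifferentiableAt (by simp))] at h
  simp only [curvature, map_sub, sub_apply]
  linarith

theorem curvature_swap (X Y Z : Π x : M, TangentSpace I x) (x : M) :
    curvature g X Y Z x = - curvature g Y X Z x := by
  unfold curvature
  rw [mlieBracket_swap_apply, map_neg]
  abel

theorem leviCivita_leviCivita_comm (hX : CMDiffAt ∞ (T% X) x) (hY : CMDiffAt ∞ (T% Y) x)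
    (hZ : CMDiffAt ∞ (T% Z) x) :
    leviCivita g (fun p ↦ leviCivita g Z p (Y p)) x (X x)
      = leviCivita g (fun p ↦ leviCivita g Y p (Z p)) x (X x)
        + leviCivita g X x (mlieBracket I Y Z x) + mlieBracket I X (mlieBracket I Y Z) x := by
  have hYZ := (contMDiffAt_leviCivita g hZ hY).mdifferentiableAt (by simp)
  have hb := (contMDiffAt_mlieBracket hY hZ).mdifferentiableAt (by simp)
  have h : ∀ᶠ p in 𝓝 x, leviCivita g Z p (Y p)
      = ((fun p ↦ leviCivita g Y p (Z p)) + mlieBracket I Y Z) p := by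
    filter_upwards [eventually_mdiffAt hY, eventually_mdiffAt hZ] with p h1 h2
    rw [Pi.add_apply, ← leviCivita_torsion g h1 h2]
    abel
  rw [leviCivita_congr g ((contMDiffAt_leviCivita g hY hZ).mdifferentiableAt (by simp)) h,
    leviCivita_add g hYZ hb, add_apply, ← leviCivita_torsion g (hX.mdifferentiableAt (by simp)) hb]
  abel

/-- The first Bianchi identity. -/
theorem curvature_bianchi (hX : CMDiffAt ∞ (T% X) x) (hY : CMDiffAt ∞ (T% Y) x)
    (hZ : CMDiffAt ∞ (T% Z) x) :
    curvature g X Y Z x + curvature g Y Z X x + curvature g Z X Y x = 0 := by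
  have : IsManifold I (minSmoothness ℝ 3) M := by
    rw [minSmoothness_of_isRCLikeNormedField]
    infer_instance
  have hle : minSmoothness ℝ 2 ≤ ∞ := by simpa using ENat.LEInfty.out
  have hJ := leibniz_identity_mlieBracket_apply (hX.of_le hle) (hY.of_le hle) (hZ.of_le hle)
  unfold curvature
  rw [leviCivita_leviCivita_comm g hX hY hZ, leviCivita_leviCivita_comm g hY hZ hX,
    leviCivita_leviCivita_comm g hZ hX hY, hJ,
    mlieBracket_swap_apply (V := Z) (W := mlieBracket I X Y), mlieBracket_swap (V := Z) (W := X)]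
  have h1 : mlieBracket I Y (-mlieBracket I X Z) x = - mlieBracket I Y (mlieBracket I X Z) x := by
    have := mlieBracket_const_smul_right (V := Y) (c := (-1 : ℝ))
      ((contMDiffAt_mlieBracket hX hZ).mdifferentiableAt (by simp))
    simpa using this
  rw [h1]
  abel

theorem inner_curvature_pair (hX : CMDiffAt ∞ (T% X) x) (hY : CMDiffAt ∞ (T% Y) x)
    (hZ : CMDiffAt ∞ (T% Z) x) (hW : CMDiffAt ∞ (T% W) x) :
    g.inner x (curvature g X Y Z x) (W x) = g.inner x (curvature g Z W X x) (Y x) := by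
  have hb : ∀ {A B C : Π x : M, TangentSpace I x} (D : Π x : M, TangentSpace I x),
      CMDiffAt ∞ (T% A) x → CMDiffAt ∞ (T% B) x → CMDiffAt ∞ (T% C) x →
      g.inner x (curvature g A B C x) (D x) + g.inner x (curvature g B C A x) (D x)
        + g.inner x (curvature g C A B x) (D x) = 0 := fun {A B C} D hA hB hC ↦ by
    have := congrArg (fun v ↦ g.inner x v (D x)) (curvature_bianchi g hA hB hC)
    simpa using this
  have hs : ∀ {A B C D : Π x : M, TangentSpace I x},
      CMDiffAt ∞ (T% A) x → CMDiffAt ∞ (T% B) x → CMDiffAt ∞ (T% C) x → CMDiffAt ∞ (T% D) x →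
      g.inner x (curvature g A B C x) (D x) = - g.inner x (curvature g A B D x) (C x) :=
    fun hA hB hC hD ↦ by rw [inner_curvature_skew g hA hB hC hD, g.symm]
  have ha : ∀ A B C D : Π x : M, TangentSpace I x,
      g.inner x (curvature g A B C x) (D x) = - g.inner x (curvature g B A C x) (D x) :=
    fun A B C D ↦ by rw [curvature_swap g A B]; simp
  have b1 := hb W hX hY hZ
  have b2 := hb X hY hZ hW
  have b3 := hb Y hZ hW hX
  have b4 := hb Z hW hX hY
  have s1 := hs hX hY hZ hW
  have s2 := hs hY hZ hX hW
  have s3 := hs hZ hX hY hW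
  have s4 := hs hZ hW hX hY
  have s5 := hs hY hW hX hZ
  have s6 := hs hW hX hY hZ
  have a1 := ha W Y Z X
  have a2 := ha W Y X Z
  have a3 := ha X Z W Y
  have a4 := ha X Z Y W
  have a5 := ha Y Z W X
  have a6 := ha W Z X Y
  have a7 := ha X W Z Y
  linarith

/-- The curvature tensor vanishes at a point as soon as it vanishes there on a family of vector
fields whose values at that point exhaust the tangent space. -/
theorem curvature_eq_zero_of_surjective (S : Set (Π x : M, TangentSpace I x))
    (hS : ∀ V ∈ S, CMDiffAt ∞ (T% V) x) (hsurj : ∀ v : TangentSpace I x, ∃ V ∈ S, V x = v)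
    (hR : ∀ U ∈ S, ∀ V ∈ S, ∀ W ∈ S, curvature g U V W x = 0)
    (hX : CMDiffAt ∞ (T% X) x) (hY : CMDiffAt ∞ (T% Y) x) (hZ : CMDiffAt ∞ (T% Z) x) :
    curvature g X Y Z x = 0 := by
  have h1 : ∀ U ∈ S, ∀ V ∈ S, ∀ A : Π x : M, TangentSpace I x, CMDiffAt ∞ (T% A) x →
      curvature g U V A x = 0 := fun U hU V hV A hA ↦ eq_of_inner_eq g fun w ↦ by
    obtain ⟨W, hW, rfl⟩ := hsurj w
    rw [inner_curvature_skew g (hS U hU) (hS V hV) hA (hS W hW), hR U hU V hV W hW]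
    simp
  have h2 : ∀ U ∈ S, curvature g X Y U x = 0 := fun U hU ↦ eq_of_inner_eq g fun w ↦ by
    obtain ⟨W, hW, rfl⟩ := hsurj w
    rw [inner_curvature_pair g hX hY (hS U hU) (hS W hW), h1 U hU W hW X hX]
    simp
  refine eq_of_inner_eq g fun w ↦ ?_
  obtain ⟨W, hW, rfl⟩ := hsurj w
  rw [inner_curvature_skew g hX hY hZ (hS W hW), h2 W hW]
  simp

end Curvature

section LiftCalculus

open Set Filter
open scoped Topology

variable {E : Type*} [NormedAddCommGroup E] [NormedSpace ℝ E] [FiniteDimensional ℝ E]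
  {H : Type*} [TopologicalSpace H] {I : ModelWithCorners ℝ E H}
  {M : Type*} [TopologicalSpace M] [ChartedSpace H M] [IsManifold I ∞ M]

/-- The inclusion of the fibre of `TM` through `ξ`, translated so that `0` is mapped to `ξ`. -/
def fibreInclusion (ξ : TangentBundle I M) (w : E) : TangentBundle I M :=
  let v : TangentSpace I ξ.proj := w
  ⟨ξ.proj, ξ.2 + v⟩

theorem fibreInclusion_zero (ξ : TangentBundle I M) : fibreInclusion ξ 0 = ξ := by
  exact congrArg (TotalSpace.mk ξ.proj) (add_zero ξ.2)

theorem contMDiff_fibreInclusion (ξ : TangentBundle I M) :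
    ContMDiff 𝓘(ℝ, E) I.tangent ∞ (fibreInclusion ξ) := by
  intro w
  rw [contMDiffAt_totalSpace]
  refine ⟨contMDiffAt_const, ?_⟩
  let e := trivializationAt E (TangentSpace I : M → Type _) ξ.proj
  let y : E := ξ.2
  let A : E →L[ℝ] E := e.continuousLinearMapAt ℝ ξ.proj
  have h : (fun w : E ↦ (e (fibreInclusion ξ w)).2) = fun w : E ↦ A (y + w) := by
    funext w
    have hx : ξ.proj ∈ e.baseSet := FiberBundle.mem_baseSet_trivializationAt' _
    exact (e.continuousLinearMapAt_apply_of_mem ℝ hx _).symm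
  change ContMDiffAt 𝓘(ℝ, E) 𝓘(ℝ, E) ∞ (fun w : E ↦ (e (fibreInclusion ξ w)).2) w
  rw [h]
  exact (A.contDiff.comp (contDiff_const.add contDiff_id)).contMDiff.contMDiffAt

theorem mdifferentiableAt_fibreInclusion (ξ : TangentBundle I M) (w : E) :
    MDifferentiableAt 𝓘(ℝ, E) I.tangent (fibreInclusion ξ) w :=
  (contMDiff_fibreInclusion ξ).mdifferentiableAt (by simp)

/-- The vertical lift as a linear map. -/
def vLiftL (ξ : TangentBundle I M) : TangentSpace I ξ.proj →L[ℝ] TangentSpace I.tangent ξ :=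
  (mfderiv 𝓘(ℝ, E) I.tangent (fibreInclusion ξ) 0 : E →L[ℝ] E × E)

theorem vLift_eq (ξ : TangentBundle I M) (v : TangentSpace I ξ.proj) : vLift ξ v = vLiftL ξ v := by
  let v' : E := v
  let c : ℝ → E := fun t ↦ t • v'
  have hc : HasFDerivAt c ((1 : ℝ →L[ℝ] ℝ).smulRight v') 0 :=
    (1 : ℝ →L[ℝ] ℝ).hasFDerivAt.smul_const v'
  have h0 : c 0 = 0 := zero_smul ℝ v'
  have h := mfderiv_comp_apply_of_eq (I := 𝓘(ℝ, ℝ)) (I' := 𝓘(ℝ, E)) (I'' := I.tangent)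
    (f := c) (g := fibreInclusion ξ) (x := (0 : ℝ)) (y := 0)
    (mdifferentiableAt_fibreInclusion ξ 0) hc.differentiableAt.mdifferentiableAt h0 (1 : ℝ)
  refine Eq.trans (b := (mfderiv 𝓘(ℝ, ℝ) I.tangent (fibreInclusion ξ ∘ c) 0 : ℝ →L[ℝ] E × E) 1)
    rfl (Eq.trans h ?_)
  rw [mfderiv_eq_fderiv, hc.fderiv]
  change (mfderiv 𝓘(ℝ, E) I.tangent (fibreInclusion ξ) 0 : E →L[ℝ] E × E) ((1 : ℝ) • v') = _
  rw [one_smul]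
  rfl

variable (g : RiemMetric I M)

/-- The differential at `x` of the vector field extending `ξ` with constant components. -/
def extendDeriv (ξ : TangentBundle I M) :
    TangentSpace I ξ.proj →L[ℝ] TangentSpace I.tangent ξ :=
  (mfderiv I I.tangent
      (fun p ↦ (⟨p, FiberBundle.extend E ξ.2 p⟩ : TangentBundle I M)) ξ.proj : E →L[ℝ] E × E)

/-- The horizontal lift as a linear map. -/
def hLiftL (ξ : TangentBundle I M) : TangentSpace I ξ.proj →L[ℝ] TangentSpace I.tangent ξ :=
  extendDeriv ξ - (vLiftL ξ).comp (leviCivita g (FiberBundle.extend E ξ.2) ξ.proj)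

theorem hLift_eq (ξ : TangentBundle I M) (u : TangentSpace I ξ.proj) :
    hLift g ξ u = hLiftL g ξ u := by
  unfold hLift hLiftL
  rw [vLift_eq]
  rfl

theorem extend_mk (ξ : TangentBundle I M) :
    (⟨ξ.proj, FiberBundle.extend E ξ.2 ξ.proj⟩ : TangentBundle I M) = ξ := by
  rw [FiberBundle.extend_apply_self]

theorem mvfderiv_vLift {F : TangentBundle I M → ℝ} {ξ : TangentBundle I M} (hF : MDiffAt F ξ)
    (v : TangentSpace I ξ.proj) :
    d% F ξ (vLift ξ v) = fderiv ℝ (fun w : E ↦ F (fibreInclusion ξ w)) 0 v := by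
  rw [vLift_eq, ← mfderiv_eq_fderiv]
  exact (mvfderiv_comp_apply_of_eq (0 : E) hF (mdifferentiableAt_fibreInclusion ξ 0)
    (fibreInclusion_zero ξ) v).symm

theorem mvfderiv_extendDeriv {F : TangentBundle I M → ℝ} {ξ : TangentBundle I M}
    (hF : MDiffAt F ξ) (u : TangentSpace I ξ.proj) :
    d% F ξ (extendDeriv ξ u)
      = d% (fun p ↦ F ⟨p, FiberBundle.extend E ξ.2 p⟩) ξ.proj u :=
  (mvfderiv_comp_apply_of_eq ξ.proj hF (FiberBundle.mdifferentiableAt_extend I E ξ.2)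
    (extend_mk ξ) u).symm

/-- The derivative of the projection `TM → M`. -/
def projDeriv (ξ : TangentBundle I M) : TangentSpace I.tangent ξ →L[ℝ] TangentSpace I ξ.proj :=
  mfderiv I.tangent I (TotalSpace.proj : TangentBundle I M → M) ξ

theorem contMDiff_tangentProj :
    ContMDiff I.tangent I ∞ (TotalSpace.proj : TangentBundle I M → M) :=
  contMDiff_proj (TangentSpace I)

theorem mdifferentiableAt_tangentProj (ξ : TangentBundle I M) :
    MDifferentiableAt I.tangent I (TotalSpace.proj : TangentBundle I M → M) ξ :=
  contMDiff_tangentProj.mdifferentiableAt (by simp)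

theorem projDeriv_vLift (ξ : TangentBundle I M) (v : TangentSpace I ξ.proj) :
    projDeriv ξ (vLift ξ v) = 0 := by
  rw [vLift_eq]
  have h := mfderiv_comp_apply_of_eq (I := 𝓘(ℝ, E)) (I' := I.tangent) (I'' := I)
    (g := TotalSpace.proj) (x := (0 : E)) (mdifferentiableAt_tangentProj ξ)
    (mdifferentiableAt_fibreInclusion ξ 0) (fibreInclusion_zero ξ) v
  refine Eq.trans h.symm ?_
  have : (TotalSpace.proj ∘ fibreInclusion ξ : E → M) = fun _ ↦ ξ.proj := rfl
  rw [this, mfderiv_const]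
  rfl

theorem projDeriv_extendDeriv (ξ : TangentBundle I M) (u : TangentSpace I ξ.proj) :
    projDeriv ξ (extendDeriv ξ u) = u := by
  have h := mfderiv_comp_apply_of_eq (I := I) (I' := I.tangent) (I'' := I)
    (g := TotalSpace.proj) (x := ξ.proj) (mdifferentiableAt_tangentProj ξ)
    (FiberBundle.mdifferentiableAt_extend I E ξ.2) (extend_mk ξ) u
  refine Eq.trans h.symm ?_
  have : (TotalSpace.proj ∘ (fun p ↦ (⟨p, FiberBundle.extend E ξ.2 p⟩ : TangentBundle I M)))
    = (id : M → M) := rfl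
  rw [this, mfderiv_id]
  rfl

theorem projDeriv_hLift (ξ : TangentBundle I M) (u : TangentSpace I ξ.proj) :
    projDeriv ξ (hLift g ξ u) = u := by
  have h : hLift g ξ u
      = extendDeriv ξ u - vLift ξ (leviCivita g (FiberBundle.extend E ξ.2) ξ.proj u) := rfl
  rw [h, map_sub, projDeriv_extendDeriv, projDeriv_vLift, sub_zero]

/-- The function `ξ ↦ g(ξ, Z)` on `TM` defined by a vector field `Z`. -/
def innerFun (Z : Π x : M, TangentSpace I x) (ξ : TangentBundle I M) : ℝ :=
  g.inner ξ.proj ξ.2 (Z ξ.proj)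

variable {g} {Z : Π x : M, TangentSpace I x} {ξ : TangentBundle I M}

theorem contMDiffAt_comp_tangentProj (hZ : CMDiffAt ∞ (T% Z) ξ.proj) :
    ContMDiffAt I.tangent I.tangent ∞
      (fun η : TangentBundle I M ↦ (⟨η.proj, Z η.proj⟩ : TangentBundle I M)) ξ :=
  ContMDiffAt.comp ξ hZ contMDiff_tangentProj.contMDiffAt

theorem contMDiffAt_innerFun (hZ : CMDiffAt ∞ (T% Z) ξ.proj) : CMDiffAt ∞ (innerFun g Z) ξ :=
  contMDiffAt_inner g (N := TangentBundle I M) (b := TotalSpace.proj) (v := fun η ↦ η.2)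
    contMDiffAt_id (contMDiffAt_comp_tangentProj hZ)

theorem mdiffAt_innerFun (hZ : MDiffAt (T% Z) ξ.proj) : MDiffAt (innerFun g Z) ξ := by
  have : MDifferentiableAt I.tangent (I.prod 𝓘(ℝ))
      (fun η : TangentBundle I M ↦ TotalSpace.mk' ℝ (E := Bundle.Trivial M ℝ) η.proj
        (g.inner η.proj η.2 (Z η.proj))) ξ := by
    apply MDifferentiableAt.clm_bundle_apply₂ (F₁ := E) (F₂ := E)
    · exact MDifferentiableAt.comp ξ (g.contMDiff.mdifferentiableAt (by simp))
        (mdifferentiableAt_tangentProj ξ)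
    · exact mdifferentiableAt_id
    · exact MDifferentiableAt.comp ξ hZ (mdifferentiableAt_tangentProj ξ)
  simp only [mdifferentiableAt_totalSpace] at this
  exact this.2

theorem mvfderiv_innerFun_vLift (hZ : MDiffAt (T% Z) ξ.proj) (v : TangentSpace I ξ.proj) :
    d% (innerFun g Z) ξ (vLift ξ v) = g.inner ξ.proj v (Z ξ.proj) := by
  rw [mvfderiv_vLift (mdiffAt_innerFun hZ)]
  let B : E →L[ℝ] E →L[ℝ] ℝ := g.inner ξ.proj
  let z : E := Z ξ.proj
  let y : E := ξ.2
  let A : E →L[ℝ] ℝ := B.flip z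
  have h : (fun w : E ↦ innerFun g Z (fibreInclusion ξ w)) = fun w : E ↦ A y + A w := by
    funext w
    exact A.map_add y w
  rw [h]
  have : HasFDerivAt (fun w : E ↦ A y + A w) A 0 := A.hasFDerivAt.const_add _
  rw [this.fderiv]
  rfl

theorem mvfderiv_innerFun_hLift (hZ : MDiffAt (T% Z) ξ.proj) (u : TangentSpace I ξ.proj) :
    d% (innerFun g Z) ξ (hLift g ξ u) = g.inner ξ.proj ξ.2 (leviCivita g Z ξ.proj u) := by
  have h : hLift g ξ u
      = extendDeriv ξ u - vLift ξ (leviCivita g (FiberBundle.extend E ξ.2) ξ.proj u) := rfl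
  rw [h, map_sub, mvfderiv_extendDeriv (mdiffAt_innerFun hZ), mvfderiv_innerFun_vLift hZ]
  have hm := leviCivita_metric g (FiberBundle.mdifferentiableAt_extend I E u)
    (FiberBundle.mdifferentiableAt_extend I E ξ.2) hZ
  simp only [FiberBundle.extend_apply_self] at hm
  rw [sub_eq_iff_eq_add', ← hm]
  rfl

theorem mvfderiv_comp_tangentProj {f : M → ℝ} (hf : MDiffAt f ξ.proj)
    (η : TangentSpace I.tangent ξ) :
    d% (fun ζ : TangentBundle I M ↦ f ζ.proj) ξ η = d% f ξ.proj (projDeriv ξ η) :=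
  mvfderiv_comp_apply ξ hf (mdifferentiableAt_tangentProj ξ) η

end LiftCalculus

section GNatural

open Set Filter
open scoped Topology

variable {E : Type*} [NormedAddCommGroup E] [NormedSpace ℝ E] [FiniteDimensional ℝ E]
  {H : Type*} [TopologicalSpace H] {I : ModelWithCorners ℝ E H}
  {M : Type*} [TopologicalSpace M] [ChartedSpace H M] [IsManifold I ∞ M]
  (g : RiemMetric I M)

/-- The vector field `Xʰ + Pᵛ` on `TM`. -/
def lift (X P : Π x : M, TangentSpace I x) (ξ : TangentBundle I M) : TangentSpace I.tangent ξ :=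
  hLift g ξ (X ξ.proj) + vLift ξ (P ξ.proj)

/-- The inner product of `uʰ + pᵛ` and `vʰ + qᵛ` for the `g`-natural metric. -/
def pairInner (a b c : ℝ) (x : M) (u p v q : TangentSpace I x) : ℝ :=
  (a + c) * g.inner x u v + b * g.inner x u q + b * g.inner x p v + a * g.inner x p q

theorem pairInner_symm (a b c : ℝ) (x : M) (u p v q : TangentSpace I x) :
    pairInner g a b c x u p v q = pairInner g a b c x v q u p := by
  unfold pairInner
  rw [g.symm x u v, g.symm x u q, g.symm x p v, g.symm x p q]
  ring

theorem pairInner_sub_left (a b c : ℝ) (x : M) (u p u' p' v q : TangentSpace I x) :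
    pairInner g a b c x (u - u') (p - p') v q
      = pairInner g a b c x u p v q - pairInner g a b c x u' p' v q := by
  simp only [pairInner, map_sub, sub_apply]
  ring

theorem mvfderiv_pairInner (a b c : ℝ) {X Y Q Z S : Π x : M, TangentSpace I x} {x : M}
    (hX : MDiffAt (T% X) x) (hY : MDiffAt (T% Y) x) (hQ : MDiffAt (T% Q) x)
    (hZ : MDiffAt (T% Z) x) (hS : MDiffAt (T% S) x) :
    MDiffAt (fun p ↦ pairInner g a b c p (Y p) (Q p) (Z p) (S p)) x ∧
    d% (fun p ↦ pairInner g a b c p (Y p) (Q p) (Z p) (S p)) x (X x)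
      = pairInner g a b c x (leviCivita g Y x (X x)) (leviCivita g Q x (X x)) (Z x) (S x)
      + pairInner g a b c x (Y x) (Q x) (leviCivita g Z x (X x)) (leviCivita g S x (X x)) := by
  have hc : ∀ r : ℝ, MDiffAt (fun _ : M ↦ r) x := fun r ↦ mdifferentiableAt_const
  have hm : ∀ (r : ℝ) {f : M → ℝ}, MDiffAt f x → MDiffAt (fun p ↦ r * f p) x :=
    fun r f hf ↦ (hc r).mul hf
  have hd : ∀ (r : ℝ) {f : M → ℝ}, MDiffAt f x →
      d% (fun p ↦ r * f p) x (X x) = r * d% f x (X x) := fun r f hf ↦ by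
    have := mvfderiv_mul (hc r) hf
    rw [mvfderiv_const] at this
    refine Eq.trans (DFunLike.congr_fun this (X x)) ?_
    simp
  have h1 := mdiffAt_inner g hY hZ
  have h2 := mdiffAt_inner g hY hS
  have h3 := mdiffAt_inner g hQ hZ
  have h4 := mdiffAt_inner g hQ hS
  have m1 := hm (a + c) h1
  have m2 := hm b h2
  have m3 := hm b h3
  have m4 := hm a h4
  refine ⟨((m1.add m2).add m3).add m4, ?_⟩
  have key := mvfderiv_add ((m1.add m2).add m3) m4
  rw [mvfderiv_add (m1.add m2) m3, mvfderiv_add m1 m2] at key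
  have := DFunLike.congr_fun key (X x)
  simp only [add_apply] at this
  rw [hd _ h1, hd _ h2, hd _ h3, hd _ h4, leviCivita_metric g hX hY hZ,
    leviCivita_metric g hX hY hS, leviCivita_metric g hX hQ hZ, leviCivita_metric g hX hQ hS]
    at this
  refine Eq.trans this ?_
  unfold pairInner
  ring

variable {g} {a b c : ℝ} {G : RiemMetric I.tangent (TangentBundle I M)}

theorem IsGNatural.inner_lift (hG : IsGNatural g a b c G) (ξ : TangentBundle I M)
    (u p v q : TangentSpace I ξ.proj) :
    G.inner ξ (hLift g ξ u + vLift ξ p) (hLift g ξ v + vLift ξ q)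
      = pairInner g a b c ξ.proj u p v q := by
  simp only [map_add, add_apply, hG.hh, hG.hv, hG.vh, hG.vv, pairInner]
  ring

theorem IsGNatural.exists_lift (hG : IsGNatural g a b c G) (ha : 0 < a)
    (hα : 0 < a * (a + c) - b ^ 2) (ξ : TangentBundle I M) (η : TangentSpace I.tangent ξ) :
    ∃ u p : TangentSpace I ξ.proj, η = hLift g ξ u + vLift ξ p := by
  let A : E →L[ℝ] E × E := hLiftL g ξ
  let B : E →L[ℝ] E × E := vLiftL ξ
  let L : E × E →ₗ[ℝ] E × E := A.toLinearMap.coprod B.toLinearMap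
  have hL : ∀ u p : TangentSpace I ξ.proj, L (u, p) = hLift g ξ u + vLift ξ p := fun u p ↦ by
    rw [hLift_eq, vLift_eq]
    rfl
  have hinj : Function.Injective L := by
    refine (injective_iff_map_eq_zero L).2 fun z hz ↦ ?_
    obtain ⟨u, p⟩ := z
    change TangentSpace I ξ.proj at u p
    have h0 : pairInner g a b c ξ.proj u p u p = 0 := by
      have hz' : hLift g ξ u + vLift ξ p = 0 := (hL u p).symm.trans hz
      rw [← hG.inner_lift, hz']
      simp
    have hnn : ∀ v : TangentSpace I ξ.proj, 0 ≤ g.inner ξ.proj v v := fun v ↦ by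
      by_cases hv : v = 0
      · simp [hv]
      · exact (g.pos _ v hv).le
    have hq := hnn (a • p + b • u)
    simp only [map_add, map_smul, add_apply, smul_apply, smul_eq_mul] at hq
    unfold pairInner at h0
    rw [g.symm _ p u] at hq h0
    have hu : u = 0 := by
      by_contra hne
      have hpos := mul_pos hα (g.pos _ u hne)
      have h1 : a * ((a + c) * g.inner ξ.proj u u + b * g.inner ξ.proj u p
        + b * g.inner ξ.proj u p + a * g.inner ξ.proj p p) = 0 := by rw [h0, mul_zero]
      linarith
    have hp : p = 0 := by
      by_contra hne
      have hpos := mul_pos ha (g.pos _ p hne)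
      rw [hu] at h0
      simp only [map_zero, zero_apply, mul_zero, zero_add] at h0
      exact hpos.ne' h0
    rw [hu, hp]
    rfl
  obtain ⟨⟨u, p⟩, h⟩ := LinearMap.injective_iff_surjective.1 hinj η
  exact ⟨u, p, h.symm.trans (hL u p)⟩

theorem projDeriv_lift (ξ : TangentBundle I M) (u p : TangentSpace I ξ.proj) :
    projDeriv ξ (hLift g ξ u + vLift ξ p) = u := by
  rw [map_add, projDeriv_hLift, projDeriv_vLift, add_zero]

theorem mvfderiv_innerFun_lift {Z : Π x : M, TangentSpace I x} {ξ : TangentBundle I M}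
    (hZ : MDiffAt (T% Z) ξ.proj) (u p : TangentSpace I ξ.proj) :
    d% (innerFun g Z) ξ (hLift g ξ u + vLift ξ p)
      = g.inner ξ.proj ξ.2 (leviCivita g Z ξ.proj u) + g.inner ξ.proj p (Z ξ.proj) := by
  rw [map_add, mvfderiv_innerFun_hLift hZ, mvfderiv_innerFun_vLift hZ]

theorem eq_zero_of_mvfderiv_eq_zero {x : M} {u : TangentSpace I x}
    (h : ∀ f : M → ℝ, CMDiffAt ∞ f x → d% f x u = 0) : u = 0 := by
  by_contra hne
  let u' : E := u
  have hne' : u' ≠ 0 := hne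
  obtain ⟨l, hl⟩ := SeparatingDual.exists_ne_zero (R := ℝ) hne'
  have hφ : ContMDiffAt I 𝓘(ℝ, E) ∞ (extChartAt I x) x := contMDiffAt_extChartAt
  have hf : CMDiffAt ∞ (l ∘ extChartAt I x) x := l.contDiff.contMDiff.contMDiffAt.comp x hφ
  have h1 := h _ hf
  have h2 := mfderiv_comp_apply (I := I) (I' := 𝓘(ℝ, E)) (I'' := 𝓘(ℝ, ℝ)) x
    (l.contDiff.contMDiff.contMDiffAt.mdifferentiableAt (n := ∞) (by simp))
    (hφ.mdifferentiableAt (by simp)) u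
  rw [mfderiv_extChartAt_self, mfderiv_eq_fderiv, l.fderiv] at h2
  exact hl (h2.symm.trans h1)

/-- Tangent vectors of `TM` are separated by the functions `f ∘ π` and `ξ ↦ g(ξ, Z)`. -/
theorem IsGNatural.eq_of_mvfderiv_eq (hG : IsGNatural g a b c G) (ha : 0 < a)
    (hα : 0 < a * (a + c) - b ^ 2) {ξ : TangentBundle I M} {η η' : TangentSpace I.tangent ξ}
    (hf : ∀ f : M → ℝ, CMDiffAt ∞ f ξ.proj →
      d% (fun ζ : TangentBundle I M ↦ f ζ.proj) ξ η
        = d% (fun ζ : TangentBundle I M ↦ f ζ.proj) ξ η')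
    (hZ : ∀ Z : Π x : M, TangentSpace I x, CMDiffAt ∞ (T% Z) ξ.proj →
      d% (innerFun g Z) ξ η = d% (innerFun g Z) ξ η') : η = η' := by
  obtain ⟨u, p, h⟩ := hG.exists_lift ha hα ξ (η - η')
  have hu : u = 0 := eq_zero_of_mvfderiv_eq_zero fun f hf' ↦ by
    have h1 := mvfderiv_comp_tangentProj (hf'.mdifferentiableAt (by simp)) (η - η')
    rw [map_sub, hf f hf', sub_self, h, projDeriv_lift] at h1
    exact h1.symm
  have hp : p = 0 := eq_of_inner_eq g fun w ↦ by
    have h1 := FiberBundle.contMDiffAt_extend (k := ∞) I E w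
    have h2 := mvfderiv_innerFun_lift (g := g) (ξ := ξ) (h1.mdifferentiableAt (by simp)) u p
    rw [← h, map_sub, hZ _ h1, sub_self, hu] at h2
    simpa using h2.symm
  rw [← sub_eq_zero, h, hu, hp, hLift_eq, vLift_eq]
  simp

end GNatural

section Flatness

open Set Filter
open scoped Topology

variable {E : Type*} [NormedAddCommGroup E] [NormedSpace ℝ E] [FiniteDimensional ℝ E]
  {H : Type*} [TopologicalSpace H] {I : ModelWithCorners ℝ E H}
  {M : Type*} [TopologicalSpace M] [ChartedSpace H M] [IsManifold I ∞ M]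
  {g : RiemMetric I M} {X P Y Q Z S : Π x : M, TangentSpace I x} {ξ : TangentBundle I M}

theorem contMDiffAt_projDeriv {W : Π η : TangentBundle I M, TangentSpace I.tangent η}
    (hW : CMDiffAt ∞ (T% W) ξ) :
    ContMDiffAt I.tangent I.tangent ∞
      (fun η ↦ (⟨η.proj, projDeriv η (W η)⟩ : TangentBundle I M)) ξ :=
  contMDiffAt_mfderiv_apply contMDiff_tangentProj.contMDiffAt hW

/-- The function `η ↦ g(η, ∇_{w(η)} Z)` is smooth, for a smooth field `w` along `TM → M`. -/
theorem contMDiffAt_inner_leviCivita_along {w : ∀ η : TangentBundle I M, TangentSpace I η.proj}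
    (hw : ContMDiffAt I.tangent I.tangent ∞
      (fun η ↦ (⟨η.proj, w η⟩ : TangentBundle I M)) ξ) (hZ : CMDiffAt ∞ (T% Z) ξ.proj) :
    CMDiffAt ∞ (fun η : TangentBundle I M ↦
      g.inner η.proj η.2 (leviCivita g Z η.proj (w η))) ξ := by
  let e := trivializationAt E (TangentSpace I : M → Type _) ξ.proj
  have hxe : ξ.proj ∈ e.baseSet := FiberBundle.mem_baseSet_trivializationAt' _
  let b := Module.finBasis ℝ E
  let s : Fin (Module.finrank ℝ E) → Π p : M, TangentSpace I p := e.localFrame b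
  have hs : ∀ i, CMDiffAt ∞ (T% (s i)) ξ.proj := fun i ↦ contMDiffAt_localFrame_of_mem _ e b i hxe
  have hcoord : ContMDiffAt I.tangent 𝓘(ℝ, E) ∞
      (fun η : TangentBundle I M ↦ (e ⟨η.proj, w η⟩).2) ξ := (contMDiffAt_totalSpace.1 hw).2
  have hsum : CMDiffAt ∞ (fun η : TangentBundle I M ↦ ∑ j, b.coord j (e ⟨η.proj, w η⟩).2
      * innerFun g (fun p ↦ leviCivita g Z p (s j p)) η) ξ := by
    refine contMDiffAt_finsetSum fun j _ ↦ ContMDiffAt.mul ?_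
      (contMDiffAt_innerFun (contMDiffAt_leviCivita g (hs j) hZ))
    exact (LinearMap.toContinuousLinearMap (b.coord j)).contDiff.contMDiff.contMDiffAt.comp ξ hcoord
  refine hsum.congr_of_eventuallyEq ?_
  have hnear : ∀ᶠ η : TangentBundle I M in 𝓝 ξ, η.proj ∈ e.baseSet :=
    contMDiff_tangentProj.continuous.continuousAt.eventually (e.open_baseSet.mem_nhds hxe)
  filter_upwards [hnear] with η hη
  have hexp : w η = ∑ j, b.coord j (e ⟨η.proj, w η⟩).2 • s j η.proj := by
    have h1 := e.eq_sum_localFrameCoeff_smul (I := I) (b := b)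
      (s := FiberBundle.extend E (w η)) hη
    have h2 (j) := e.localFrameCoeff_eq_coeff (I := I) (b := b) (i := j)
      (s := FiberBundle.extend E (w η)) hη
    simp only [FiberBundle.extend_apply_self] at h1 h2
    simp only [h2] at h1
    exact h1
  conv_lhs => rw [hexp]
  simp only [map_sum, map_smul, smul_eq_mul, innerFun]

variable {a b c : ℝ} {G : RiemMetric I.tangent (TangentBundle I M)}

theorem IsGNatural.contMDiffAt_lift (hG : IsGNatural g a b c G) (ha : 0 < a)
    (hα : 0 < a * (a + c) - b ^ 2) (hX : CMDiffAt ∞ (T% X) ξ.proj)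
    (hP : CMDiffAt ∞ (T% P) ξ.proj) : CMDiffAt ∞ (T% (lift g X P)) ξ := by
  refine contMDiffAt_of_inner G fun W hW ↦ ?_
  have hw := contMDiffAt_projDeriv hW
  have hV : ∀ {V : Π x : M, TangentSpace I x}, CMDiffAt ∞ (T% V) ξ.proj →
      CMDiffAt ∞ (fun η : TangentBundle I M ↦
        g.inner η.proj (V η.proj) (projDeriv η (W η))) ξ ∧
      CMDiffAt ∞ (fun η : TangentBundle I M ↦ d% (innerFun g V) η (W η)
        - g.inner η.proj η.2 (leviCivita g V η.proj (projDeriv η (W η)))) ξ := fun hV ↦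
    ⟨contMDiffAt_inner g (contMDiffAt_comp_tangentProj hV) hw,
      (contMDiffAt_mvfderiv_apply (contMDiffAt_innerFun hV) hW).sub
        (contMDiffAt_inner_leviCivita_along hw hV)⟩
  have hc : ∀ (r : ℝ) {f : TangentBundle I M → ℝ}, CMDiffAt ∞ f ξ →
      CMDiffAt ∞ (fun η ↦ r * f η) ξ :=
    fun r f hf ↦ contMDiffAt_const.mul hf
  have hsum := (((hc (a + c) (hV hX).1).add (hc b (hV hX).2)).add (hc b (hV hP).1)).add
    (hc a (hV hP).2)
  refine hsum.congr_of_eventuallyEq ?_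
  have hπ := contMDiff_tangentProj (I := I) (M := M).continuous.continuousAt (x := ξ)
  filter_upwards [hπ.eventually (eventually_mdiffAt hX), hπ.eventually (eventually_mdiffAt hP)]
    with η h1 h2
  obtain ⟨u, p, hup⟩ := hG.exists_lift ha hα η (W η)
  simp only [Pi.add_apply]
  rw [hup, projDeriv_lift, mvfderiv_innerFun_lift h1, mvfderiv_innerFun_lift h2]
  unfold lift
  rw [hG.inner_lift, g.symm _ p, g.symm _ p]
  unfold pairInner
  ring

theorem mvfderiv_comp_tangentProj_lift {f : M → ℝ} (hf : MDiffAt f ξ.proj) :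
    d% (fun ζ : TangentBundle I M ↦ f ζ.proj) ξ (lift g X P ξ) = d% f ξ.proj (X ξ.proj) := by
  rw [mvfderiv_comp_tangentProj hf]
  exact congrArg _ (projDeriv_lift ξ _ _)

theorem eventually_mdiffAt_of_fun {f : M → ℝ} {x : M} (hf : CMDiffAt ∞ f x) :
    ∀ᶠ p in 𝓝 x, MDiffAt f p :=
  ((contMDiffAt_iff_contMDiffAt_nhds (n := 1) (by simp)).1 (hf.of_le (by simp))).mono
    fun p hp ↦ hp.mdifferentiableAt (by simp)

theorem mvfderiv_mvfderiv_comp_tangentProj {f : M → ℝ} (hf : CMDiffAt ∞ f ξ.proj)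
    (hY : CMDiffAt ∞ (T% Y) ξ.proj) :
    d% (fun ζ ↦ d% (fun ζ' : TangentBundle I M ↦ f ζ'.proj) ζ (lift g Y Q ζ)) ξ (lift g X P ξ)
      = d% (fun p ↦ d% f p (Y p)) ξ.proj (X ξ.proj) := by
  have hπ := contMDiff_tangentProj (I := I) (M := M).continuous.continuousAt (x := ξ)
  have h : (fun ζ ↦ d% (fun ζ' : TangentBundle I M ↦ f ζ'.proj) ζ (lift g Y Q ζ)) =ᶠ[𝓝 ξ]
      fun ζ ↦ (fun p ↦ d% f p (Y p)) ζ.proj :=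
    (hπ.eventually (eventually_mdiffAt_of_fun hf)).mono fun ζ hζ ↦
      mvfderiv_comp_tangentProj_lift hζ
  rw [mvfderiv_congr h]
  exact mvfderiv_comp_tangentProj_lift
    ((contMDiffAt_mvfderiv_apply hf hY).mdifferentiableAt (by simp))

theorem mvfderiv_mvfderiv_innerFun (hX : CMDiffAt ∞ (T% X) ξ.proj) (hY : CMDiffAt ∞ (T% Y) ξ.proj)
    (hQ : CMDiffAt ∞ (T% Q) ξ.proj) (hZ : CMDiffAt ∞ (T% Z) ξ.proj) :
    d% (fun ζ ↦ d% (innerFun g Z) ζ (lift g Y Q ζ)) ξ (lift g X P ξ)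
      = g.inner ξ.proj ξ.2
          (leviCivita g (fun p ↦ leviCivita g Z p (Y p)) ξ.proj (X ξ.proj))
        + g.inner ξ.proj (P ξ.proj) (leviCivita g Z ξ.proj (Y ξ.proj))
        + (g.inner ξ.proj (leviCivita g Q ξ.proj (X ξ.proj)) (Z ξ.proj)
          + g.inner ξ.proj (Q ξ.proj) (leviCivita g Z ξ.proj (X ξ.proj))) := by
  have hπ := contMDiff_tangentProj (I := I) (M := M).continuous.continuousAt (x := ξ)
  have h : (fun ζ ↦ d% (innerFun g Z) ζ (lift g Y Q ζ)) =ᶠ[𝓝 ξ]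
      innerFun g (fun p ↦ leviCivita g Z p (Y p))
        + fun ζ : TangentBundle I M ↦ g.inner ζ.proj (Q ζ.proj) (Z ζ.proj) :=
    (hπ.eventually (eventually_mdiffAt hZ)).mono fun ζ hζ ↦ mvfderiv_innerFun_lift hζ _ _
  have hYZ := (contMDiffAt_leviCivita g hY hZ).mdifferentiableAt (by simp)
  have hQZ := (contMDiffAt_inner g hQ hZ).mdifferentiableAt (by simp)
  have hQZ' : MDiffAt (fun ζ : TangentBundle I M ↦ g.inner ζ.proj (Q ζ.proj) (Z ζ.proj)) ξ :=
    hQZ.comp ξ (mdifferentiableAt_tangentProj ξ)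
  rw [mvfderiv_congr h, mvfderiv_add (mdiffAt_innerFun hYZ) hQZ', add_apply]
  congr 1
  · exact mvfderiv_innerFun_lift hYZ _ _
  · rw [← leviCivita_metric g (hX.mdifferentiableAt (by simp)) (hQ.mdifferentiableAt (by simp))
      (hZ.mdifferentiableAt (by simp))]
    exact mvfderiv_comp_tangentProj_lift hQZ

/-- The bracket of lifts to the tangent bundle of a flat manifold. -/
theorem IsGNatural.mlieBracket_lift (hG : IsGNatural g a b c G) (ha : 0 < a)
    (hα : 0 < a * (a + c) - b ^ 2) (hflat : IsFlat g)
    (hX : CMDiffAt ∞ (T% X) ξ.proj) (hP : CMDiffAt ∞ (T% P) ξ.proj)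
    (hY : CMDiffAt ∞ (T% Y) ξ.proj) (hQ : CMDiffAt ∞ (T% Q) ξ.proj) :
    mlieBracket I.tangent (lift g X P) (lift g Y Q) ξ
      = hLift g ξ (leviCivita g Y ξ.proj (X ξ.proj) - leviCivita g X ξ.proj (Y ξ.proj))
        + vLift ξ (leviCivita g Q ξ.proj (X ξ.proj) - leviCivita g P ξ.proj (Y ξ.proj)) := by
  have hL := hG.contMDiffAt_lift ha hα hX hP
  have hL' := hG.contMDiffAt_lift ha hα hY hQ
  have hb := leviCivita_torsion g (hX.mdifferentiableAt (by simp)) (hY.mdifferentiableAt (by simp))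
  refine hG.eq_of_mvfderiv_eq ha hα (fun f hf ↦ ?_) fun Z hZ ↦ ?_
  · have hf' : CMDiffAt ∞ (fun ζ : TangentBundle I M ↦ f ζ.proj) ξ :=
      ContMDiffAt.comp ξ hf contMDiff_tangentProj.contMDiffAt
    rw [mvfderiv_mlieBracket hf' hL hL',
      mvfderiv_mvfderiv_comp_tangentProj hf hY, mvfderiv_mvfderiv_comp_tangentProj hf hX,
      mvfderiv_comp_tangentProj (hf.mdifferentiableAt (by simp)), projDeriv_lift, hb,
      mvfderiv_mlieBracket hf hX hY]
  · have hR := hflat ξ.proj X Y Z hX hY hZ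
    unfold curvature at hR
    have hR' := congrArg (g.inner ξ.proj ξ.2) hR
    rw [mvfderiv_mlieBracket (contMDiffAt_innerFun hZ) hL hL',
      mvfderiv_mvfderiv_innerFun hX hY hQ hZ, mvfderiv_mvfderiv_innerFun hY hX hP hZ,
      mvfderiv_innerFun_lift (hZ.mdifferentiableAt (by simp)), hb]
    simp only [map_sub, sub_apply, map_zero] at hR' ⊢
    linarith

/-- The Levi-Civita connection of a `g`-natural metric on the tangent bundle of a flat manifold:
`∇_(Xʰ + Pᵛ) (Yʰ + Qᵛ) = (∇_X Y)ʰ + (∇_X Q)ᵛ`. -/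
theorem IsGNatural.leviCivita_lift (hG : IsGNatural g a b c G) (ha : 0 < a)
    (hα : 0 < a * (a + c) - b ^ 2) (hflat : IsFlat g)
    (hX : CMDiffAt ∞ (T% X) ξ.proj) (hP : CMDiffAt ∞ (T% P) ξ.proj)
    (hY : CMDiffAt ∞ (T% Y) ξ.proj) (hQ : CMDiffAt ∞ (T% Q) ξ.proj) :
    leviCivita G (lift g Y Q) ξ (lift g X P ξ)
      = lift g (fun p ↦ leviCivita g Y p (X p)) (fun p ↦ leviCivita g Q p (X p)) ξ := by
  have hd : ∀ {X P Y Q Z S : Π x : M, TangentSpace I x},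
      CMDiffAt ∞ (T% X) ξ.proj → CMDiffAt ∞ (T% Y) ξ.proj → CMDiffAt ∞ (T% Q) ξ.proj →
      CMDiffAt ∞ (T% Z) ξ.proj → CMDiffAt ∞ (T% S) ξ.proj →
      d% (fun η ↦ G.inner η (lift g Y Q η) (lift g Z S η)) ξ (lift g X P ξ)
        = pairInner g a b c ξ.proj (leviCivita g Y ξ.proj (X ξ.proj))
            (leviCivita g Q ξ.proj (X ξ.proj)) (Z ξ.proj) (S ξ.proj)
          + pairInner g a b c ξ.proj (Y ξ.proj) (Q ξ.proj) (leviCivita g Z ξ.proj (X ξ.proj))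
            (leviCivita g S ξ.proj (X ξ.proj)) := by
    intro X P Y Q Z S hX hY hQ hZ hS
    have h := mvfderiv_pairInner g a b c (hX.mdifferentiableAt (by simp))
      (hY.mdifferentiableAt (by simp)) (hQ.mdifferentiableAt (by simp))
      (hZ.mdifferentiableAt (by simp)) (hS.mdifferentiableAt (by simp))
    have he : (fun η ↦ G.inner η (lift g Y Q η) (lift g Z S η)) = fun η : TangentBundle I M ↦
        (fun p ↦ pairInner g a b c p (Y p) (Q p) (Z p) (S p)) η.proj :=
      funext fun η ↦ hG.inner_lift η _ _ _ _
    rw [he, ← h.2]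
    exact mvfderiv_comp_tangentProj_lift h.1
  refine eq_of_inner_eq G fun ζ ↦ ?_
  obtain ⟨u, p, rfl⟩ := hG.exists_lift ha hα ξ ζ
  let Z : Π x : M, TangentSpace I x := FiberBundle.extend E u
  let S : Π x : M, TangentSpace I x := FiberBundle.extend E p
  have hZ : CMDiffAt ∞ (T% Z) ξ.proj := FiberBundle.contMDiffAt_extend I E u
  have hS : CMDiffAt ∞ (T% S) ξ.proj := FiberBundle.contMDiffAt_extend I E p
  have hLZ : hLift g ξ u + vLift ξ p = lift g Z S ξ := by simp [lift, Z, S]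
  have hk := inner_nabla G ((hG.contMDiffAt_lift ha hα hX hP).mdifferentiableAt (by simp))
    ((hG.contMDiffAt_lift ha hα hY hQ).mdifferentiableAt (by simp))
    ((hG.contMDiffAt_lift ha hα hZ hS).mdifferentiableAt (by simp))
  unfold koszul at hk
  rw [hd hX hY hQ hZ hS, hd hY hX hP hZ hS, hd hZ hX hP hY hQ,
    hG.mlieBracket_lift ha hα hflat hX hP hY hQ, hG.mlieBracket_lift ha hα hflat hX hP hZ hS,
    hG.mlieBracket_lift ha hα hflat hY hQ hZ hS] at hk
  rw [hLZ]
  change G.inner ξ (nabla G (lift g Y Q) ξ (lift g X P ξ)) (lift g Z S ξ) = _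
  unfold lift at hk ⊢
  simp only [hG.inner_lift, pairInner_sub_left] at hk ⊢
  have s1 := pairInner_symm g a b c ξ.proj (X ξ.proj) (P ξ.proj)
    (leviCivita g Y ξ.proj (Z ξ.proj)) (leviCivita g Q ξ.proj (Z ξ.proj))
  have s2 := pairInner_symm g a b c ξ.proj (X ξ.proj) (P ξ.proj)
    (leviCivita g Z ξ.proj (Y ξ.proj)) (leviCivita g S ξ.proj (Y ξ.proj))
  have s3 := pairInner_symm g a b c ξ.proj (Y ξ.proj) (Q ξ.proj)
    (leviCivita g Z ξ.proj (X ξ.proj)) (leviCivita g S ξ.proj (X ξ.proj))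
  linarith

theorem IsGNatural.curvature_lift (hG : IsGNatural g a b c G) (ha : 0 < a)
    (hα : 0 < a * (a + c) - b ^ 2) (hflat : IsFlat g)
    (hX : ∀ᶠ p in 𝓝 ξ.proj, CMDiffAt ∞ (T% X) p) (hP : ∀ᶠ p in 𝓝 ξ.proj, CMDiffAt ∞ (T% P) p)
    (hY : ∀ᶠ p in 𝓝 ξ.proj, CMDiffAt ∞ (T% Y) p) (hQ : ∀ᶠ p in 𝓝 ξ.proj, CMDiffAt ∞ (T% Q) p)
    (hZ : ∀ᶠ p in 𝓝 ξ.proj, CMDiffAt ∞ (T% Z) p) (hS : ∀ᶠ p in 𝓝 ξ.proj, CMDiffAt ∞ (T% S) p) :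
    curvature G (lift g X P) (lift g Y Q) (lift g Z S) ξ = 0 := by
  have hπ := contMDiff_tangentProj (I := I) (M := M).continuous.continuousAt (x := ξ)
  have hZ₀ := hZ.self_of_nhds
  have hS₀ := hS.self_of_nhds
  have key : ∀ {X P Y Q : Π x : M, TangentSpace I x},
      (∀ᶠ p in 𝓝 ξ.proj, CMDiffAt ∞ (T% X) p) → (∀ᶠ p in 𝓝 ξ.proj, CMDiffAt ∞ (T% P) p) →
      (∀ᶠ p in 𝓝 ξ.proj, CMDiffAt ∞ (T% Y) p) → (∀ᶠ p in 𝓝 ξ.proj, CMDiffAt ∞ (T% Q) p) →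
      leviCivita G (fun η ↦ leviCivita G (lift g Z S) η (lift g Y Q η)) ξ (lift g X P ξ)
        = lift g (fun p ↦ leviCivita g (fun q ↦ leviCivita g Z q (Y q)) p (X p))
          (fun p ↦ leviCivita g (fun q ↦ leviCivita g S q (Y q)) p (X p)) ξ := by
    intro X P Y Q hX hP hY hQ
    have hev : ∀ᶠ η in 𝓝 ξ, leviCivita G (lift g Z S) η (lift g Y Q η)
        = lift g (fun p ↦ leviCivita g Z p (Y p)) (fun p ↦ leviCivita g S p (Y p)) η := by
      filter_upwards [hπ.eventually hY, hπ.eventually hQ, hπ.eventually hZ, hπ.eventually hS]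
        with η h1 h2 h3 h4
      exact hG.leviCivita_lift ha hα hflat h1 h2 h3 h4
    have hd := (contMDiffAt_leviCivita G (hG.contMDiffAt_lift ha hα hY.self_of_nhds hQ.self_of_nhds)
      (hG.contMDiffAt_lift ha hα hZ₀ hS₀)).mdifferentiableAt (by simp)
    rw [leviCivita_congr G hd hev]
    exact hG.leviCivita_lift ha hα hflat hX.self_of_nhds hP.self_of_nhds
      (contMDiffAt_leviCivita g hY.self_of_nhds hZ₀) (contMDiffAt_leviCivita g hY.self_of_nhds hS₀)
  have hbr : mlieBracket I.tangent (lift g X P) (lift g Y Q) ξ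
      = lift g (mlieBracket I X Y)
        ((fun p ↦ leviCivita g Q p (X p)) - fun p ↦ leviCivita g P p (Y p)) ξ := by
    rw [hG.mlieBracket_lift ha hα hflat hX.self_of_nhds hP.self_of_nhds hY.self_of_nhds
      hQ.self_of_nhds, leviCivita_torsion g (hX.self_of_nhds.mdifferentiableAt (by simp))
      (hY.self_of_nhds.mdifferentiableAt (by simp))]
    rfl
  have hvert : CMDiffAt ∞
      (T% ((fun p ↦ leviCivita g Q p (X p)) - fun p ↦ leviCivita g P p (Y p))) ξ.proj :=
    (contMDiffAt_leviCivita g hX.self_of_nhds hQ.self_of_nhds).sub_section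
      (contMDiffAt_leviCivita g hY.self_of_nhds hP.self_of_nhds)
  have hRZ := hflat ξ.proj X Y Z hX.self_of_nhds hY.self_of_nhds hZ₀
  have hRS := hflat ξ.proj X Y S hX.self_of_nhds hY.self_of_nhds hS₀
  unfold curvature at hRZ hRS ⊢
  rw [key hX hP hY hQ, key hY hQ hX hP, hbr,
    hG.leviCivita_lift ha hα hflat (contMDiffAt_mlieBracket hX.self_of_nhds hY.self_of_nhds) hvert
      hZ₀ hS₀]
  unfold lift
  simp only [hLift_eq, vLift_eq]
  have h1 := congrArg (hLiftL g ξ) hRZ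
  have h2 := congrArg (vLiftL ξ) hRS
  simp only [map_sub, map_zero] at h1 h2
  rw [← add_zero (0 : TangentSpace I.tangent ξ)]
  nth_rw 1 [← h1]
  rw [← h2]
  abel

theorem eventually_contMDiffAt_extend {x : M} (v : TangentSpace I x) :
    ∀ᶠ p in 𝓝 x, CMDiffAt ∞ (T% (FiberBundle.extend E v)) p := by
  obtain ⟨s, hs, h⟩ := FiberBundle.exists_contMDiffOn_extend (k := ∞) I E v
  filter_upwards [eventually_mem_nhds_iff.2 hs] with p hp
  exact h.contMDiffAt hp

/-- A `g`-natural metric on the tangent bundle of a flat manifold is flat. -/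
theorem IsGNatural.isFlat (hG : IsGNatural g a b c G) (ha : 0 < a)
    (hα : 0 < a * (a + c) - b ^ 2) (hflat : IsFlat g) : IsFlat G := by
  intro ξ U V W hU hV hW
  refine curvature_eq_zero_of_surjective G
    {L | ∃ X P : Π x : M, TangentSpace I x, (∀ᶠ p in 𝓝 ξ.proj, CMDiffAt ∞ (T% X) p) ∧
      (∀ᶠ p in 𝓝 ξ.proj, CMDiffAt ∞ (T% P) p) ∧ L = lift g X P} ?_ (fun η ↦ ?_) ?_ hU hV hW
  · rintro _ ⟨X, P, hX, hP, rfl⟩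
    exact hG.contMDiffAt_lift ha hα hX.self_of_nhds hP.self_of_nhds
  · obtain ⟨u, p, rfl⟩ := hG.exists_lift ha hα ξ η
    exact ⟨_, ⟨_, _, eventually_contMDiffAt_extend u, eventually_contMDiffAt_extend p, rfl⟩,
      by simp [lift]⟩
  · rintro _ ⟨X, P, hX, hP, rfl⟩ _ ⟨Y, Q, hY, hQ, rfl⟩ _ ⟨Z, S, hZ, hS, rfl⟩
    exact hG.curvature_lift ha hα hflat hX hP hY hQ hZ hS

end Flatness

end GNat

end

theorem stmt_11 {n : ℕ} (hn : 3 ≤ n)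
    {M : Type*} [TopologicalSpace M] [T2Space M] [SecondCountableTopology M]
    [ChartedSpace (EuclideanSpace ℝ (Fin n)) M] [IsManifold (𝓡 n) ∞ M]
    (g : GNat.RiemMetric (𝓡 n) M)
    (a b c : ℝ) (ha : 0 < a) (hα : 0 < a * (a + c) - b ^ 2)
    (G : GNat.RiemMetric (𝓡 n).tangent (TangentBundle (𝓡 n) M))
    (hG : GNat.IsGNatural g a b c G)
    (hflat : GNat.IsFlat g) :
    GNat.IsFlat G := by
  exact hG.isFlat ha hα hflat
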